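/- arXiv:2511.10889 — 3 statements merged into one kernel-verified Lean document; each statement's English description precedes it below -/
import Mathlib

section
/- Let G be a graph. Then G is (P_7,C_4,C_6)-free, contains an induced C_7, and admits no clique-cutset if and only if G is (4K_1,C_4,C_6)-free and contains an induced C_7. -/
open SimpleGraph

namespace Paper2P3

variable {V : Type*}

/-- `G` contains an induced subgraph isomorphic to `H`. -/
def ContainsInduced {V W : Type*} (G : SimpleGraph V) (H : SimpleGraph W) : Prop :=
  ∃ s : Set V, Nonempty (H ≃g G.induce s)

/-- `G` is `H`-free: no induced subgraph of `G` is isomorphic to `H`. -/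
def HFree {V W : Type*} (G : SimpleGraph V) (H : SimpleGraph W) : Prop :=
  ¬ ContainsInduced G H

/-- `S` is complete to `T` in `G`. -/
def Complete (G : SimpleGraph V) (S T : Set V) : Prop :=
  ∀ a ∈ S, ∀ b ∈ T, G.Adj a b

/-- `S` is anticomplete to `T` in `G`. -/
def Anticomplete (G : SimpleGraph V) (S T : Set V) : Prop :=
  ∀ a ∈ S, ∀ b ∈ T, ¬ G.Adj a b

/-- The closed neighborhood `N_G[v]`. -/
def closedNbhd (G : SimpleGraph V) (v : V) : Set V := insert v (G.neighborSet v)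

/-- A simplicial vertex: its neighborhood is a clique. -/
def IsSimplicial (G : SimpleGraph V) (v : V) : Prop := G.IsClique (G.neighborSet v)

/-- A universal vertex: adjacent to all other vertices. -/
def IsUniversalVertex (G : SimpleGraph V) (v : V) : Prop := ∀ w, w ≠ v → G.Adj v w

/-- `G` admits a clique-cutset: a clique `C ⊊ V(G)` such that `G - C` is disconnected. -/
def HasCliqueCutset (G : SimpleGraph V) : Prop :=
  ∃ C : Set V, G.IsClique C ∧ C ≠ Set.univ ∧ ¬ (G.induce Cᶜ).Connected

/-- The disjoint union of two copies of `P_3`, on vertices `0,1,2` and `3,4,5`. -/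
def twoP3 : SimpleGraph (Fin 6) :=
  SimpleGraph.fromRel fun a b => (a, b) ∈ ([(0,1),(1,2),(3,4),(4,5)] : List (Fin 6 × Fin 6))

/-- The edgeless graph on four vertices. -/
def fourK1 : SimpleGraph (Fin 4) := ⊥

/-- `Gs` is a thickening of `G`. -/
def IsThickening {α β : Type*} (Gs : SimpleGraph β) (G : SimpleGraph α) : Prop :=
  ∃ X : α → Set β,
    (∀ v, (X v).Nonempty) ∧
    (∀ u v : α, u ≠ v → Disjoint (X u) (X v)) ∧
    (⋃ v, X v) = Set.univ ∧
    (∀ v, Gs.IsClique (X v)) ∧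
    (∀ u v : α, u ≠ v →
      (G.Adj u v → Complete Gs (X u) (X v)) ∧ (¬ G.Adj u v → Anticomplete Gs (X u) (X v)))

/-- The closed neighborhoods of the vertices of `S` form a chain under inclusion;
equivalently (for finite graphs), `S` can be ordered as `a_1, …, a_r` with
`N_G[a_r] ⊆ ⋯ ⊆ N_G[a_1]`. -/
def ChainClosedNbhd (G : SimpleGraph V) (S : Set V) : Prop :=
  ∀ a ∈ S, ∀ b ∈ S, closedNbhd G a ⊆ closedNbhd G b ∨ closedNbhd G b ⊆ closedNbhd G a

/-- `A` can be partitioned into cliques, pairwise anticomplete to each other. -/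
def CliquesPartition (G : SimpleGraph V) (A : Set V) : Prop :=
  ∃ (ℓ : ℕ) (P : Fin ℓ → Set V),
    (∀ i, G.IsClique (P i)) ∧
    (∀ i j, i ≠ j → Disjoint (P i) (P j)) ∧
    (∀ i j, i ≠ j → Anticomplete G (P i) (P j)) ∧
    (⋃ i, P i) = A

/-- `A` can be partitioned into nonempty cliques, pairwise anticomplete to each other. -/
def NonemptyCliquesPartition (G : SimpleGraph V) (A : Set V) : Prop :=
  ∃ (ℓ : ℕ) (P : Fin ℓ → Set V),
    (∀ i, (P i).Nonempty) ∧
    (∀ i, G.IsClique (P i)) ∧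
    (∀ i j, i ≠ j → Disjoint (P i) (P j)) ∧
    (∀ i j, i ≠ j → Anticomplete G (P i) (P j)) ∧
    (⋃ i, P i) = A

/-- `A` can be partitioned into nonempty cliques, pairwise anticomplete to each other,
each of which can be ordered so that the closed neighborhoods form a decreasing chain. -/
def OrderedCliquesPartition (G : SimpleGraph V) (A : Set V) : Prop :=
  ∃ (ℓ : ℕ) (P : Fin ℓ → Set V),
    (∀ i, (P i).Nonempty) ∧
    (∀ i, G.IsClique (P i)) ∧
    (∀ i j, i ≠ j → Disjoint (P i) (P j)) ∧
    (∀ i j, i ≠ j → Anticomplete G (P i) (P j)) ∧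
    (⋃ i, P i) = A ∧
    (∀ i, ChainClosedNbhd G (P i))

/-- `(X_0,…,X_6; Y_0,…,Y_6; Z_0,…,Z_6; W)` is a special partition of the induced
subgraph of `G` on `S` (indices in `ℤ_7`). -/
def IsSpecialPartitionOn (G : SimpleGraph V) (S : Set V)
    (X Y Z : ZMod 7 → Set V) (W : Set V) : Prop :=
  -- the sets are pairwise disjoint and their union is `S`
  (∀ i j, i ≠ j → Disjoint (X i) (X j)) ∧
  (∀ i j, i ≠ j → Disjoint (Y i) (Y j)) ∧
  (∀ i j, i ≠ j → Disjoint (Z i) (Z j)) ∧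
  (∀ i j, Disjoint (X i) (Y j)) ∧
  (∀ i j, Disjoint (X i) (Z j)) ∧
  (∀ i j, Disjoint (Y i) (Z j)) ∧
  (∀ i, Disjoint (X i) W) ∧ (∀ i, Disjoint (Y i) W) ∧ (∀ i, Disjoint (Z i) W) ∧
  ((⋃ i, X i) ∪ (⋃ i, Y i) ∪ (⋃ i, Z i) ∪ W = S) ∧
  -- all the sets are cliques
  (∀ i, G.IsClique (X i)) ∧ (∀ i, G.IsClique (Y i)) ∧ (∀ i, G.IsClique (Z i)) ∧
  G.IsClique W ∧
  -- (a)
  (∀ i, (X i).Nonempty) ∧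
  -- (b)
  (∀ i, Complete G (X i) (X (i - 1)) ∧ Complete G (X i) (X (i + 1)) ∧
    Anticomplete G (X i) (X (i + 2)) ∧ Anticomplete G (X i) (X (i + 3)) ∧
    Anticomplete G (X i) (X (i + 4)) ∧ Anticomplete G (X i) (X (i + 5))) ∧
  -- (c)
  (∀ i, Complete G (X i) (Y i) ∧ Complete G (X i) (Y (i + 3)) ∧
    Complete G (X i) (Y (i + 6)) ∧ Complete G (X i) (Z i) ∧
    Complete G (X i) (Z (i + 3)) ∧ Complete G (X i) (Z (i + 4)) ∧
    Complete G (X i) (Z (i + 5)) ∧ Complete G (X i) (Z (i + 6)) ∧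
    Complete G (X i) W ∧
    Anticomplete G (X i) (Y (i + 1)) ∧ Anticomplete G (X i) (Y (i + 2)) ∧
    Anticomplete G (X i) (Y (i + 4)) ∧ Anticomplete G (X i) (Y (i + 5)) ∧
    Anticomplete G (X i) (Z (i + 1)) ∧ Anticomplete G (X i) (Z (i + 2))) ∧
  -- (d)
  (∀ i, (Y i).Nonempty →
    (Y (i + 1) = ∅ ∧ Y (i + 2) = ∅ ∧ Y (i + 5) = ∅ ∧ Y (i + 6) = ∅ ∧
      Z (i + 5) = ∅ ∧ Z (i + 6) = ∅) ∧ (Y (i + 3) = ∅ ∨ Y (i + 4) = ∅)) ∧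
  -- (e)
  (∀ i, (Z i).Nonempty → Z (i + 2) = ∅ ∧ Z (i + 5) = ∅) ∧
  -- (f)
  (∀ i, Complete G (Y i) (Y (i + 3)) ∧ Complete G (Y i) (Y (i + 4)) ∧
    Complete G (Y i) (Z i) ∧ Complete G (Y i) (Z (i + 1)) ∧
    Complete G (Y i) (Z (i + 3)) ∧ Complete G (Y i) (Z (i + 4)) ∧
    Complete G (Y i) W ∧ Anticomplete G (Y i) (Z (i + 2))) ∧
  -- (g)
  (∀ i, Complete G (Z i) (Z (i + 1)) ∧ Complete G (Z i) (Z (i + 3)) ∧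
    Complete G (Z i) (Z (i + 4)) ∧ Complete G (Z i) (Z (i + 6)) ∧ Complete G (Z i) W)

/-- `G` admits a special partition. -/
def AdmitsSpecialPartition (G : SimpleGraph V) : Prop :=
  ∃ (X Y Z : ZMod 7 → Set V) (W : Set V), IsSpecialPartitionOn G Set.univ X Y Z W

/-- `G` is a 7-saucer. -/
def IsSevenSaucer (G : SimpleGraph V) : Prop :=
  ∃ (X Y Z : ZMod 7 → Set V) (W A : Set V),
    IsSpecialPartitionOn G Aᶜ X Y Z W ∧
    (∀ i, Anticomplete G A (X i)) ∧
    (∀ i, Anticomplete G A (Y i) ∨ Z (i + 2) = ∅) ∧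
    (A = ∅ ∨ OrderedCliquesPartition G A)
/-- The graph `M_0`: vertices `0,…,6` are `x_0,…,x_6` (a 7-cycle), `7 = y_0`,
`8 = y_3`, `9 = z_0`, `10 = z_3`, `11 = z_4`. -/
def M0 : SimpleGraph (Fin 12) :=
  SimpleGraph.fromRel fun a b => (a, b) ∈
    ([(0,1),(1,2),(2,3),(3,4),(4,5),(5,6),(6,0),
      (7,0),(7,1),(7,4),
      (8,3),(8,4),(8,0),
      (9,0),(9,1),(9,2),(9,3),(9,4),
      (10,3),(10,4),(10,5),(10,6),(10,0),
      (11,4),(11,5),(11,6),(11,0),(11,1),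
      (7,8),(7,9),(7,10),(7,11),(8,9),(8,10),(8,11),(9,10),(9,11),(10,11)] :
      List (Fin 12 × Fin 12))

/-- The graph `M_1`: vertices `0,…,6` are `x_0,…,x_6` (a 7-cycle), `7 = y_0`, `8 = z_2`. -/
def M1 : SimpleGraph (Fin 9) :=
  SimpleGraph.fromRel fun a b => (a, b) ∈
    ([(0,1),(1,2),(2,3),(3,4),(4,5),(5,6),(6,0),
      (7,0),(7,1),(7,4),
      (8,2),(8,3),(8,4),(8,5),(8,6)] : List (Fin 9 × Fin 9))

/-- The graph `M_2`: `M_1` plus the vertex `9 = z_1`. -/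
def M2 : SimpleGraph (Fin 10) :=
  SimpleGraph.fromRel fun a b => (a, b) ∈
    ([(0,1),(1,2),(2,3),(3,4),(4,5),(5,6),(6,0),
      (7,0),(7,1),(7,4),
      (8,2),(8,3),(8,4),(8,5),(8,6),
      (9,1),(9,2),(9,3),(9,4),(9,5),(9,7),(9,8)] : List (Fin 10 × Fin 10))

/-- The graph `M_3`: `M_1` plus the vertex `9 = z_3`. -/
def M3 : SimpleGraph (Fin 10) :=
  SimpleGraph.fromRel fun a b => (a, b) ∈
    ([(0,1),(1,2),(2,3),(3,4),(4,5),(5,6),(6,0),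
      (7,0),(7,1),(7,4),
      (8,2),(8,3),(8,4),(8,5),(8,6),
      (9,3),(9,4),(9,5),(9,6),(9,0),(9,7),(9,8)] : List (Fin 10 × Fin 10))

/-- The set `{y_0, y_3, z_0, z_3, z_4}` of vertices of `M_0`. -/
def M0Extra : Set (Fin 12) := {7, 8, 9, 10, 11}

/-- `H` is a thickening of a graph in the family `ℳ`, which consists of
`M_1`, `M_2`, `M_3`, and all graphs `M_0 - S` for `S ⊆ {y_0,y_3,z_0,z_3,z_4}`. -/
def IsThickeningOfM {β : Type*} (H : SimpleGraph β) : Prop :=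
  IsThickening H M1 ∨ IsThickening H M2 ∨ IsThickening H M3 ∨
  ∃ S : Set (Fin 12), S ⊆ M0Extra ∧ IsThickening H (M0.induce Sᶜ)
/-- The graph `T_0`: vertices `0 = a_0`, `1 = a_1`, `2 = b_0`, `3 = b_1`, `4 = b_2`,
`5 = b_3`, `6 = c_1`, `7 = c_2`, `8 = c_3`. -/
def T0 : SimpleGraph (Fin 9) :=
  SimpleGraph.fromRel fun a b => (a, b) ∈
    ([(0,1),(0,2),(0,4),(0,5),(1,3),(1,4),(1,5),
      (2,6),(3,6),(4,7),(5,8),(6,7),(6,8),(7,8)] : List (Fin 9 × Fin 9))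

/-- The graph `T_1`: `T_0` plus the vertex `9 = f_3`, adjacent to
`a_0,a_1,b_0,b_1,b_2,c_1,c_2` and nonadjacent to `b_3,c_3`. -/
def T1 : SimpleGraph (Fin 10) :=
  SimpleGraph.fromRel fun a b => (a, b) ∈
    ([(0,1),(0,2),(0,4),(0,5),(1,3),(1,4),(1,5),
      (2,6),(3,6),(4,7),(5,8),(6,7),(6,8),(7,8),
      (9,0),(9,1),(9,2),(9,3),(9,4),(9,6),(9,7)] : List (Fin 10 × Fin 10))
/-- `(A_0,A_1;B_0,B_1,B_2,B_3;C_1,C_2,C_3;F_2,F_3;W;Y;Z)` is a tent partition of `G`. -/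
def IsTentPartition (G : SimpleGraph V)
    (A0 A1 B0 B1 B2 B3 C1 C2 C3 F2 F3 W Y Z : Set V) : Prop :=
  let P : Fin 14 → Set V := ![A0, A1, B0, B1, B2, B3, C1, C2, C3, F2, F3, W, Y, Z]
  -- the fourteen sets form a partition of the vertex set
  (∀ i j : Fin 14, i ≠ j → Disjoint (P i) (P j)) ∧
  (⋃ i, P i) = Set.univ ∧
  -- A_0,A_1,B_0,B_1,B_2,B_3,C_1,C_2,C_3 are nonempty cliques
  (A0.Nonempty ∧ A1.Nonempty ∧ B0.Nonempty ∧ B1.Nonempty ∧ B2.Nonempty ∧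
    B3.Nonempty ∧ C1.Nonempty ∧ C2.Nonempty ∧ C3.Nonempty) ∧
  (G.IsClique A0 ∧ G.IsClique A1 ∧ G.IsClique B0 ∧ G.IsClique B1 ∧ G.IsClique B2 ∧
    G.IsClique B3 ∧ G.IsClique C1 ∧ G.IsClique C2 ∧ G.IsClique C3) ∧
  -- F_2, F_3, Y are cliques, and at most one of them is nonempty
  (G.IsClique F2 ∧ G.IsClique F3 ∧ G.IsClique Y) ∧
  ((F2 = ∅ ∧ F3 = ∅) ∨ (F2 = ∅ ∧ Y = ∅) ∨ (F3 = ∅ ∧ Y = ∅)) ∧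
  -- W is a (possibly empty) clique
  G.IsClique W ∧
  Complete G A0 A1 ∧
  (Complete G A0 B0 ∧ Complete G A0 B2 ∧ Complete G A0 B3 ∧
    Anticomplete G A0 B1 ∧ Anticomplete G A0 C1 ∧ Anticomplete G A0 C2 ∧
    Anticomplete G A0 C3) ∧
  (Complete G A1 B1 ∧ Complete G A1 B2 ∧ Complete G A1 B3 ∧
    Anticomplete G A1 B0 ∧ Anticomplete G A1 C1 ∧ Anticomplete G A1 C2 ∧
    Anticomplete G A1 C3) ∧
  (Anticomplete G B0 B1 ∧ Anticomplete G B0 B2 ∧ Anticomplete G B0 B3 ∧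
    Anticomplete G B1 B2 ∧ Anticomplete G B1 B3 ∧ Anticomplete G B2 B3) ∧
  (Complete G C1 C2 ∧ Complete G C1 C3 ∧ Complete G C2 C3) ∧
  (Complete G C1 B0 ∧ Complete G C1 B1 ∧ Anticomplete G C1 B2 ∧ Anticomplete G C1 B3) ∧
  (Complete G C2 B2 ∧ Anticomplete G C2 B0 ∧ Anticomplete G C2 B1 ∧
    Anticomplete G C2 B3) ∧
  (Complete G C3 B3 ∧ Anticomplete G C3 B0 ∧ Anticomplete G C3 B1 ∧
    Anticomplete G C3 B2) ∧
  (Complete G F2 A0 ∧ Complete G F2 A1 ∧ Complete G F2 B0 ∧ Complete G F2 B1 ∧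
    Complete G F2 B3 ∧ Complete G F2 C1 ∧ Complete G F2 C3 ∧
    Anticomplete G F2 B2 ∧ Anticomplete G F2 C2) ∧
  (Complete G F3 A0 ∧ Complete G F3 A1 ∧ Complete G F3 B0 ∧ Complete G F3 B1 ∧
    Complete G F3 B2 ∧ Complete G F3 C1 ∧ Complete G F3 C2 ∧
    Anticomplete G F3 B3 ∧ Anticomplete G F3 C3) ∧
  (Complete G W A0 ∧ Complete G W A1 ∧ Complete G W B0 ∧ Complete G W B1 ∧
    Complete G W B2 ∧ Complete G W B3 ∧ Complete G W C1 ∧ Complete G W C2 ∧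
    Complete G W C3 ∧ Complete G W F2 ∧ Complete G W F3) ∧
  (Complete G Y C2 ∧ Complete G Y C3 ∧
    Anticomplete G Y A0 ∧ Anticomplete G Y A1 ∧ Anticomplete G Y B0 ∧
    Anticomplete G Y B1 ∧ Anticomplete G Y B2 ∧ Anticomplete G Y B3 ∧
    Anticomplete G Y C1) ∧
  (Anticomplete G Z A0 ∧ Anticomplete G Z A1 ∧ Anticomplete G Z B0 ∧
    Anticomplete G Z B1 ∧ Anticomplete G Z B2 ∧ Anticomplete G Z B3 ∧
    Anticomplete G Z C1 ∧ Anticomplete G Z C2 ∧ Anticomplete G Z C3 ∧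
    Anticomplete G Z Y) ∧
  -- Y can be ordered so that the closed neighborhoods form a chain
  ChainClosedNbhd G Y ∧
  -- Z is empty or can be partitioned into nonempty cliques, pairwise anticomplete,
  -- each ordered so that the closed neighborhoods form a chain
  (Z = ∅ ∨ OrderedCliquesPartition G Z)

/-- `G` is a tent. -/
def IsTent (G : SimpleGraph V) : Prop :=
  ∃ A0 A1 B0 B1 B2 B3 C1 C2 C3 F2 F3 W Y Z : Set V,
    IsTentPartition G A0 A1 B0 B1 B2 B3 C1 C2 C3 F2 F3 W Y Z

theorem containsInduced_iff {V W : Type*} {G : SimpleGraph V} {H : SimpleGraph W} :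
    ContainsInduced G H ↔ Nonempty (H ↪g G) :=
  isIndContained_iff_exists_iso_induce.symm

section InducedSubgraphs

variable {G : SimpleGraph V}

theorem HFree.false_of_map {W : Type*} {H : SimpleGraph W} (hG : HFree G H) (f : W → V)
    (hf : ∀ i j, G.Adj (f i) (f j) ↔ H.Adj i j)
    (hH : ∀ i j, (∀ k, H.Adj i k ↔ H.Adj j k) → i = j) : False := by
  refine hG (containsInduced_iff.2 ⟨⟨⟨f, fun i j hij => hH i j fun k => ?_⟩, fun {i j} => hf i j⟩⟩)
  rw [← hf, ← hf, hij]

theorem HFree.false_of_C4 (hG : HFree G (cycleGraph 4)) {a b c d : V}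
    (hab : G.Adj a b) (hbc : G.Adj b c) (hcd : G.Adj c d) (hda : G.Adj d a)
    (hac : ¬ G.Adj a c) (hbd : ¬ G.Adj b d) (hac' : a ≠ c) (hbd' : b ≠ d) : False := by
  have hinj : Function.Injective ![a, b, c, d] := by
    intro i j
    fin_cases i <;> fin_cases j <;>
      simp [hac', hbd', hac'.symm, hbd'.symm, hab.ne, hbc.ne, hcd.ne, hda.ne, hab.ne', hbc.ne',
        hcd.ne', hda.ne']
  refine hG (containsInduced_iff.2 ⟨⟨⟨_, hinj⟩, fun {i j} => ?_⟩⟩)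
  fin_cases i <;> fin_cases j <;>
    simp [cycleGraph_adj, hab, hbc, hcd, hda, hab.symm, hbc.symm, hcd.symm, hda.symm, hac, hbd,
      G.adj_comm c a, G.adj_comm d b] <;> decide

theorem HFree.false_of_C6 (hG : HFree G (cycleGraph 6)) {a b c d e f : V}
    (hab : G.Adj a b) (hbc : G.Adj b c) (hcd : G.Adj c d) (hde : G.Adj d e) (hef : G.Adj e f)
    (hfa : G.Adj f a)
    (hac : ¬ G.Adj a c) (had : ¬ G.Adj a d) (hae : ¬ G.Adj a e)
    (hbd : ¬ G.Adj b d) (hbe : ¬ G.Adj b e) (hbf : ¬ G.Adj b f)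
    (hce : ¬ G.Adj c e) (hcf : ¬ G.Adj c f) (hdf : ¬ G.Adj d f) : False := by
  refine hG.false_of_map ![a, b, c, d, e, f] (fun i j => ?_) (by
    simp only [cycleGraph_adj]; decide)
  fin_cases i <;> fin_cases j <;>
    simp [cycleGraph_adj, hab, hbc, hcd, hde, hef, hfa, hab.symm, hbc.symm, hcd.symm, hde.symm,
      hef.symm, hfa.symm, hac, had, hae, hbd, hbe, hbf, hce, hcf, hdf, G.adj_comm c a,
      G.adj_comm d a, G.adj_comm e a, G.adj_comm d b, G.adj_comm e b, G.adj_comm f b,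
      G.adj_comm e c, G.adj_comm f c, G.adj_comm f d] <;> decide

theorem HFree.false_of_P7 (hG : HFree G (pathGraph 7)) {a b c d e f g : V}
    (hab : G.Adj a b) (hbc : G.Adj b c) (hcd : G.Adj c d) (hde : G.Adj d e) (hef : G.Adj e f)
    (hfg : G.Adj f g)
    (hac : ¬ G.Adj a c) (had : ¬ G.Adj a d) (hae : ¬ G.Adj a e) (haf : ¬ G.Adj a f)
    (hag : ¬ G.Adj a g)
    (hbd : ¬ G.Adj b d) (hbe : ¬ G.Adj b e) (hbf : ¬ G.Adj b f) (hbg : ¬ G.Adj b g)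
    (hce : ¬ G.Adj c e) (hcf : ¬ G.Adj c f) (hcg : ¬ G.Adj c g)
    (hdf : ¬ G.Adj d f) (hdg : ¬ G.Adj d g) (heg : ¬ G.Adj e g) : False := by
  refine hG.false_of_map ![a, b, c, d, e, f, g] (fun i j => ?_) (by
    simp only [pathGraph_adj]; decide)
  fin_cases i <;> fin_cases j <;>
    simp [pathGraph_adj, hab, hbc, hcd, hde, hef, hfg, hab.symm, hbc.symm, hcd.symm, hde.symm,
      hef.symm, hfg.symm, hac, had, hae, haf, hag, hbd, hbe, hbf, hbg, hce, hcf, hcg, hdf, hdg,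
      heg, G.adj_comm c a, G.adj_comm d a, G.adj_comm e a, G.adj_comm f a, G.adj_comm g a,
      G.adj_comm d b, G.adj_comm e b, G.adj_comm f b, G.adj_comm g b, G.adj_comm e c,
      G.adj_comm f c, G.adj_comm g c, G.adj_comm f d, G.adj_comm g d, G.adj_comm g e]

theorem HFree.false_of_fourK1 (hG : HFree G fourK1) {a b c d : V}
    (hab : a ≠ b) (hac : a ≠ c) (had : a ≠ d) (hbc : b ≠ c) (hbd : b ≠ d) (hcd : c ≠ d)
    (hab' : ¬ G.Adj a b) (hac' : ¬ G.Adj a c) (had' : ¬ G.Adj a d) (hbc' : ¬ G.Adj b c)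
    (hbd' : ¬ G.Adj b d) (hcd' : ¬ G.Adj c d) : False := by
  have hinj : Function.Injective ![a, b, c, d] := by
    intro i j
    fin_cases i <;> fin_cases j <;>
      simp [hab, hac, had, hbc, hbd, hcd, hab.symm, hac.symm, had.symm, hbc.symm, hbd.symm,
        hcd.symm]
  refine hG (containsInduced_iff.2 ⟨⟨⟨_, hinj⟩, fun {i j} => ?_⟩⟩)
  fin_cases i <;> fin_cases j <;>
    simp [fourK1, hab', hac', had', hbc', hbd', hcd', G.adj_comm b a, G.adj_comm c a,
      G.adj_comm d a, G.adj_comm c b, G.adj_comm d b, G.adj_comm d c]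

end InducedSubgraphs

/-- The possible nonempty closed neighborhoods of a vertex on an induced 7-cycle:
the kinds `0, 1, 2, 3` correspond to the letters `X`, `Y`, `Z`, `W`. -/
def profile : Fin 4 → Fin 7 → Finset (Fin 7)
  | 0, i => {i - 1, i, i + 1}
  | 1, i => {i, i + 1, i + 4}
  | 2, i => {i, i + 1, i + 2, i + 3, i + 4}
  | 3, _ => Finset.univ

/-- The pairs of profiles that two distinct nonadjacent vertices can have. -/
def profilesSeparate (k : Fin 4) (i : Fin 7) (l : Fin 4) (j : Fin 7) : Bool :=
  match k, l with
  | 0, 0 => j - i != 0 && j - i != 1 && j - i != 6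
  | 0, 1 => i - j != 0 && i - j != 1 && i - j != 4
  | 1, 0 => j - i != 0 && j - i != 1 && j - i != 4
  | 0, 2 => i - j == 5 || i - j == 6
  | 2, 0 => j - i == 5 || j - i == 6
  | 1, 2 => j - i == 2
  | 2, 1 => i - j == 2
  | _, _ => false

theorem profile_of_gaps : ∀ S : Finset (Fin 7), (∀ i ∈ S, i + 2 ∈ S → i + 1 ∈ S) →
    (∀ i ∈ S, i + 4 ∈ S → i + 1 ∈ S ∨ i + 2 ∈ S ∨ i + 3 ∈ S) →
    (∀ i, S ≠ {i}) → (∀ i, S ≠ {i, i + 1}) → S = ∅ ∨ ∃ k i, S = profile k i := by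
  decide +kernel

theorem card_profile : ∀ k i, (profile k i).card = 3 ∨ (profile k i).card = 5 ∨
    (profile k i).card = 7 := by
  decide +kernel

set_option synthInstance.maxSize 2000 in
theorem profilesSeparate_of : ∀ k i l j,
    (∀ p ∈ profile k i, p ∈ profile l j → ∀ q ∈ profile k i, q ∈ profile l j →
      p = q ∨ q = p + 1 ∨ p = q + 1) →
    (k = 0 → i ∉ profile l j) → (l = 0 → j ∉ profile k i) → ¬ (k = 1 ∧ l = 1) →
    (k = 1 → l = 2 → j = i + 2) → (l = 1 → k = 2 → i = j + 2) →
    profilesSeparate k i l j = true := by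
  decide +kernel

theorem not_four_profilesSeparate : ∀ k₁ i₁ k₂ i₂, profilesSeparate k₁ i₁ k₂ i₂ = true →
    ∀ k₃ i₃, profilesSeparate k₁ i₁ k₃ i₃ = true → profilesSeparate k₂ i₂ k₃ i₃ = true →
    ∀ k₄ i₄, profilesSeparate k₁ i₁ k₄ i₄ = true → profilesSeparate k₂ i₂ k₄ i₄ = true →
    profilesSeparate k₃ i₃ k₄ i₄ = true → False := by
  decide +kernel

theorem profilesSeparate_ne_zero : ∀ k i l j, k ≠ 0 → l ≠ 0 → profilesSeparate k i l j = true →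
    (k = 1 ∧ l = 2 ∧ j = i + 2) ∨ (l = 1 ∧ k = 2 ∧ i = j + 2) := by
  decide +kernel

theorem exists_of_pairwise_consecutive : ∀ S : Finset (Fin 7),
    (∀ p ∈ S, ∀ q ∈ S, p = q ∨ q = p + 1 ∨ p = q + 1) →
    ∃ i, ∀ j ∈ S, j = i ∨ j = i + 1 := by
  decide +kernel

/-- `c` enumerates an induced 7-cycle of `G` in cyclic order. -/
def IsC7 (G : SimpleGraph V) (c : Fin 7 → V) : Prop :=
  ∀ i j, G.Adj (c i) (c j) ↔ j = i + 1 ∨ i = j + 1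

open Classical in
/-- The indices of the vertices of `c` that are equal or adjacent to `v`. -/
noncomputable def cycleNbhd (G : SimpleGraph V) (c : Fin 7 → V) (v : V) : Finset (Fin 7) :=
  {i | v = c i ∨ G.Adj v (c i)}

section SevenCycle

variable {G : SimpleGraph V} {c : Fin 7 → V} {u v : V}

theorem mem_cycleNbhd {i : Fin 7} : i ∈ cycleNbhd G c v ↔ v = c i ∨ G.Adj v (c i) := by
  simp [cycleNbhd]

theorem exists_isC7 (hG : ContainsInduced G (cycleGraph 7)) : ∃ c, IsC7 G c := by
  obtain ⟨f⟩ := containsInduced_iff.1 hG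
  refine ⟨f, fun i j => ?_⟩
  rw [f.map_adj_iff, cycleGraph_adj]
  revert i j
  decide

namespace IsC7

theorem adj (h : IsC7 G c) {i j : Fin 7} (hij : j = i + 1 ∨ i = j + 1) : G.Adj (c i) (c j) :=
  (h i j).2 hij

theorem not_adj (h : IsC7 G c) {i j : Fin 7} (hij : ¬ (j = i + 1 ∨ i = j + 1)) :
    ¬ G.Adj (c i) (c j) :=
  mt (h i j).1 hij

theorem injective (h : IsC7 G c) : Function.Injective c := by
  intro i j hij
  have key : ∀ i j : Fin 7, (∀ k : Fin 7, (k = i + 1 ∨ i = k + 1) ↔ (k = j + 1 ∨ j = k + 1)) →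
      i = j := by decide
  exact key i j fun k => by rw [← h, ← h, hij]

theorem rotate (h : IsC7 G c) (r : Fin 7) : IsC7 G fun i => c (i + r) := by
  intro i j
  rw [h]
  revert i j r
  decide

theorem cycleNbhd_self (h : IsC7 G c) (i : Fin 7) : cycleNbhd G c (c i) = profile 0 i := by
  ext j
  rw [mem_cycleNbhd, h.injective.eq_iff, h]
  revert i j
  decide

theorem mem_cycleNbhd_of_ne (hv : ∀ i, v ≠ c i) {i : Fin 7} :
    i ∈ cycleNbhd G c v ↔ G.Adj v (c i) := by
  simp [mem_cycleNbhd, hv i]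

theorem cycleNbhd_eq_profile (h : IsC7 G c) (h₄ : HFree G (cycleGraph 4))
    (h₆ : HFree G (cycleGraph 6)) (h₇ : HFree G (pathGraph 7)) (v : V) :
    cycleNbhd G c v = ∅ ∨ ∃ k i, cycleNbhd G c v = profile k i := by
  by_cases hv : ∃ i, v = c i
  · obtain ⟨i, rfl⟩ := hv
    exact Or.inr ⟨0, i, h.cycleNbhd_self i⟩
  push Not at hv
  apply profile_of_gaps
  · intro i hi hi2
    rw [mem_cycleNbhd_of_ne hv] at *
    by_contra hi1
    refine h₄.false_of_C4 hi (h.adj (j := i + 1) ?_) (h.adj (j := i + 2) ?_) hi2.symm hi1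
      (h.not_adj ?_) (hv _) (h.injective.ne ?_) <;> (clear hi hi1 hi2; revert i; decide)
  · intro i hi hi4
    simp only [mem_cycleNbhd_of_ne hv] at *
    by_contra! hn
    obtain ⟨h1, h2, h3⟩ := hn
    refine h₆.false_of_C6 hi (h.adj (j := i + 1) ?_) (h.adj (j := i + 2) ?_)
      (h.adj (j := i + 3) ?_) (h.adj (j := i + 4) ?_) hi4.symm h1 h2 h3 (h.not_adj ?_)
      (h.not_adj ?_) (h.not_adj ?_) (h.not_adj ?_) (h.not_adj ?_) (h.not_adj ?_) <;>
      (clear hi h1 h2 h3 hi4; revert i; decide)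
  · intro i hi
    have hadj (j : Fin 7) : G.Adj v (c j) ↔ j = i := by
      rw [← mem_cycleNbhd_of_ne hv, hi, Finset.mem_singleton]
    refine h₇.false_of_P7 (a := v) (b := c i) (c := c (i + 1)) (d := c (i + 2)) (e := c (i + 3))
      (f := c (i + 4)) (g := c (i + 5)) ?_ ?_ ?_ ?_ ?_ ?_ ?_ ?_ ?_ ?_ ?_ ?_ ?_ ?_ ?_ ?_ ?_ ?_ ?_
      ?_ ?_ <;> simp only [hadj, h _ _] <;> (clear hadj hi; revert i; decide)
  · intro i hi
    have hadj (j : Fin 7) : G.Adj v (c j) ↔ j = i ∨ j = i + 1 := by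
      rw [← mem_cycleNbhd_of_ne hv, hi, Finset.mem_insert, Finset.mem_singleton]
    refine h₇.false_of_P7 (a := v) (b := c (i + 1)) (c := c (i + 2)) (d := c (i + 3))
      (e := c (i + 4)) (f := c (i + 5)) (g := c (i + 6)) ?_ ?_ ?_ ?_ ?_ ?_ ?_ ?_ ?_ ?_ ?_ ?_ ?_
      ?_ ?_ ?_ ?_ ?_ ?_ ?_ ?_ <;> simp only [hadj, h _ _] <;> (clear hadj hi; revert i; decide)

/-- Replacing a vertex of an induced 7-cycle by one with the same closed neighborhood on the
cycle gives an induced 7-cycle. -/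
theorem update (h : IsC7 G c) {i : Fin 7} (hu : cycleNbhd G c u = profile 0 i) :
    IsC7 G (Function.update c i u) := by
  have hadj (j : Fin 7) (hj : j ≠ i) : G.Adj u (c j) ↔ j = i + 1 ∨ i = j + 1 := by
    have hmem : ∀ i j : Fin 7, j ≠ i → (j ∈ profile 0 i ↔ j = i + 1 ∨ i = j + 1) := by decide
    have hinj : ∀ i j : Fin 7, profile 0 j = profile 0 i → j = i := by decide
    rw [← hmem i j hj, ← hu, mem_cycleNbhd, or_iff_right]
    rintro rfl
    exact hj (hinj i j (h.cycleNbhd_self j ▸ hu))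
  intro p q
  rcases eq_or_ne p i with rfl | hp <;> rcases eq_or_ne q p with rfl | hqp
  · simp
  · simp [hqp, hadj q hqp]
  · simp [hp]
  · rcases eq_or_ne q i with rfl | hq
    · simp [hp, G.adj_comm, hadj p hp, or_comm]
    · simp [hp, hq, h p q]

/-- A vertex with the same closed neighborhood on an induced 7-cycle as a vertex of the cycle
is a true twin of that vertex. -/
theorem twin (h : IsC7 G c) (h₄ : HFree G (cycleGraph 4)) (h₆ : HFree G (cycleGraph 6))
    (h₇ : HFree G (pathGraph 7)) {i : Fin 7} (hu : cycleNbhd G c u = profile 0 i) (v : V) :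
    (v = u ∨ G.Adj v u) ↔ i ∈ cycleNbhd G c v := by
  have hi : i ∈ cycleNbhd G (Function.update c i u) v ↔ v = u ∨ G.Adj v u := by
    simp [mem_cycleNbhd]
  have hj : (cycleNbhd G (Function.update c i u) v).erase i = (cycleNbhd G c v).erase i := by
    ext j
    by_cases hji : j = i <;> simp [mem_cycleNbhd, hji]
  have card {c' : Fin 7 → V} (h' : IsC7 G c') : (cycleNbhd G c' v).card = 0 ∨
      (cycleNbhd G c' v).card = 3 ∨ (cycleNbhd G c' v).card = 5 ∨
      (cycleNbhd G c' v).card = 7 := by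
    rcases h'.cycleNbhd_eq_profile h₄ h₆ h₇ v with h0 | ⟨k, j, hk⟩
    · simp [h0]
    · rw [hk]
      exact Or.inr (card_profile k j)
  have h1 := card h
  have h2 := card (h.update hu)
  rw [← hi]
  have h3 := congrArg Finset.card hj
  rw [Finset.card_erase_eq_ite, Finset.card_erase_eq_ite] at h3
  by_cases ha : i ∈ cycleNbhd G (Function.update c i u) v <;> by_cases hb : i ∈ cycleNbhd G c v
  · simp [ha, hb]
  · have := Finset.card_pos.2 ⟨i, ha⟩
    simp only [ha, hb, if_true, if_false] at h3
    omega
  · have := Finset.card_pos.2 ⟨i, hb⟩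
    simp only [ha, hb, if_true, if_false] at h3
    omega
  · simp [ha, hb]

/-- Rotating an induced 7-cycle shifts the profiles of the vertices outside the cycle. -/
theorem exists_rotate (h : IsC7 G c) (r : Fin 7) : ∃ d, IsC7 G d ∧
    (∀ {v k i}, k ≠ 0 → cycleNbhd G c v = profile k i →
      ∀ j, G.Adj v (d j) ↔ j ∈ profile k (i - r)) ∧
    ∀ {v}, cycleNbhd G c v = ∅ → ∀ j, ¬ G.Adj v (d j) := by
  have shift : ∀ (k : Fin 4) (i j r : Fin 7), j ∈ profile k (i - r) ↔ j + r ∈ profile k i := by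
    decide +kernel
  have ne : ∀ (k : Fin 4) (i j : Fin 7), k ≠ 0 → profile 0 j ≠ profile k i := by decide +kernel
  refine ⟨_, h.rotate r, fun {v k i} hk hv j => ?_, fun {v} hv j hadj => ?_⟩
  · rw [shift, ← hv, mem_cycleNbhd_of_ne]
    rintro j rfl
    exact ne k i j hk (h.cycleNbhd_self j ▸ hv)
  · have := mem_cycleNbhd.2 (Or.inr hadj)
    simp [hv] at this

/-- Any two distinct vertices whose neighborhoods on an induced 7-cycle have the form
`{i, i + 1, i + 4}` are adjacent. -/
theorem adj_of_profile_one (h : IsC7 G c) (h₄ : HFree G (cycleGraph 4))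
    (h₆ : HFree G (cycleGraph 6)) (h₇ : HFree G (pathGraph 7)) {i j : Fin 7} (huv : u ≠ v)
    (hu : cycleNbhd G c u = profile 1 i) (hv : cycleNbhd G c v = profile 1 j) : G.Adj u v := by
  by_contra hn
  wlog hij : j - i ≠ 5 ∧ j - i ≠ 6 generalizing u v i j
  · refine this huv.symm hv hu (fun hvu => hn hvu.symm) ?_
    clear this hu hv
    revert i j
    decide
  obtain ⟨d, hc, hprofile, -⟩ := h.exists_rotate i
  have hu' := hprofile (by decide) hu
  have hv' := hprofile (by decide) hv
  rw [sub_self] at hu'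
  generalize j - i = s at hv' hij
  have hvu : ¬ G.Adj v u := fun hvu => hn hvu.symm
  have hu'' (j : Fin 7) : G.Adj (d j) u ↔ j ∈ profile 1 0 := by rw [G.adj_comm, hu']
  have hv'' (j : Fin 7) : G.Adj (d j) v ↔ j ∈ profile 1 s := by rw [G.adj_comm, hv']
  have hcases : ∀ s : Fin 7, s ≠ 5 ∧ s ≠ 6 → s = 0 ∨ s = 1 ∨ s = 2 ∨ s = 3 ∨ s = 4 := by decide
  rcases hcases s hij with rfl | rfl | rfl | rfl | rfl
  · refine h₄.false_of_C4 (a := d 0) (b := u) (c := d 4) (d := v) ?_ ?_ ?_ ?_ ?_ hn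
      (hc.injective.ne (by decide)) huv <;> simp only [hu', hu'', hv', hv'', hc _ _] <;> decide
  · refine h₇.false_of_P7 (a := d 3) (b := d 2) (c := v) (d := d 5) (e := d 6) (f := d 0) (g := u)
      ?_ ?_ ?_ ?_ ?_ ?_ ?_ ?_ ?_ ?_ ?_ ?_ ?_ ?_ ?_ ?_ ?_ hvu ?_ ?_ ?_ <;>
      simp only [hu'', hv', hv'', hc _ _] <;> decide
  · refine h₆.false_of_C6 (a := u) (b := d 0) (c := d 6) (d := v) (e := d 3) (f := d 4)
      ?_ ?_ ?_ ?_ ?_ ?_ ?_ hn ?_ ?_ ?_ ?_ ?_ ?_ ?_ <;>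
      simp only [hu', hu'', hv', hv'', hc _ _] <;> decide
  · refine h₄.false_of_C4 (a := d 0) (b := u) (c := d 4) (d := v) ?_ ?_ ?_ ?_ ?_ hn
      (hc.injective.ne (by decide)) huv <;> simp only [hu', hu'', hv', hv'', hc _ _] <;> decide
  · refine h₄.false_of_C4 (a := d 1) (b := u) (c := d 4) (d := v) ?_ ?_ ?_ ?_ ?_ hn
      (hc.injective.ne (by decide)) huv <;> simp only [hu', hu'', hv', hv'', hc _ _] <;> decide

theorem eq_add_two_of_not_adj (h : IsC7 G c) (h₄ : HFree G (cycleGraph 4))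
    (h₆ : HFree G (cycleGraph 6)) {i j : Fin 7} (huv : u ≠ v) (hn : ¬ G.Adj u v)
    (hu : cycleNbhd G c u = profile 1 i) (hv : cycleNbhd G c v = profile 2 j) : j = i + 2 := by
  obtain ⟨d, hc, hprofile, -⟩ := h.exists_rotate i
  have hu' := hprofile (by decide) hu
  have hv' := hprofile (by decide) hv
  rw [sub_self] at hu'
  suffices hs : j - i = 2 by rw [← hs, add_sub_cancel]
  generalize j - i = s at hv'
  have hu'' (j : Fin 7) : G.Adj (d j) u ↔ j ∈ profile 1 0 := by rw [G.adj_comm, hu']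
  have hv'' (j : Fin 7) : G.Adj (d j) v ↔ j ∈ profile 2 s := by rw [G.adj_comm, hv']
  have hcases : ∀ s : Fin 7, s = 2 ∨ (s = 0 ∨ s = 3 ∨ s = 4) ∨ s = 1 ∨ s = 5 ∨ s = 6 := by decide
  by_contra hs
  rcases (hcases s).resolve_left hs with hs | rfl | rfl | rfl
  · refine h₄.false_of_C4 (a := d 0) (b := u) (c := d 4) (d := v) ?_ ?_ ?_ ?_ ?_ hn
      (hc.injective.ne (by decide)) huv <;> rcases hs with rfl | rfl | rfl <;>
      simp only [hu', hu'', hv', hv'', hc _ _] <;> decide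
  · refine h₄.false_of_C4 (a := d 1) (b := u) (c := d 4) (d := v) ?_ ?_ ?_ ?_ ?_ hn
      (hc.injective.ne (by decide)) huv <;> simp only [hu', hu'', hv', hv'', hc _ _] <;> decide
  · refine h₆.false_of_C6 (a := d 0) (b := u) (c := d 4) (d := d 3) (e := d 2) (f := v)
      ?_ ?_ ?_ ?_ ?_ ?_ ?_ ?_ ?_ ?_ ?_ hn ?_ ?_ ?_ <;>
      simp only [hu', hu'', hv', hv'', hc _ _] <;> decide
  · refine h₆.false_of_C6 (a := d 1) (b := u) (c := d 4) (d := d 5) (e := d 6) (f := v)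
      ?_ ?_ ?_ ?_ ?_ ?_ ?_ ?_ ?_ ?_ ?_ hn ?_ ?_ ?_ <;>
      simp only [hu', hu'', hv', hv'', hc _ _] <;> decide

theorem profilesSeparate_of_not_adj (h : IsC7 G c) (h₄ : HFree G (cycleGraph 4))
    (h₆ : HFree G (cycleGraph 6)) (h₇ : HFree G (pathGraph 7)) {k l : Fin 4} {i j : Fin 7}
    (huv : u ≠ v) (hn : ¬ G.Adj u v) (hu : cycleNbhd G c u = profile k i)
    (hv : cycleNbhd G c v = profile l j) : profilesSeparate k i l j = true := by
  have hn' : ¬ G.Adj v u := fun h' => hn h'.symm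
  apply profilesSeparate_of
  · rw [← hu, ← hv]
    have adj {p : Fin 7} (hpu : p ∈ cycleNbhd G c u) (hpv : p ∈ cycleNbhd G c v) :
        G.Adj u (c p) ∧ G.Adj v (c p) := by
      rw [mem_cycleNbhd] at hpu hpv
      rcases hpu with rfl | hpu <;> rcases hpv with rfl | hpv <;> tauto
    intro p hpu hpv q hqu hqv
    by_contra! hpq
    exact h₄.false_of_C4 (adj hpu hpv).1.symm (adj hqu hqv).1 (adj hqu hqv).2.symm
      (adj hpu hpv).2 (h.not_adj (by tauto)) hn (h.injective.ne hpq.1) huv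
  · rintro rfl hi
    rw [← hv, ← h.twin h₄ h₆ h₇ hu] at hi
    exact hi.elim huv.symm hn'
  · rintro rfl hj
    rw [← hu, ← h.twin h₄ h₆ h₇ hv] at hj
    exact hj.elim huv hn
  · rintro ⟨rfl, rfl⟩
    exact hn (h.adj_of_profile_one h₄ h₆ h₇ huv hu hv)
  · rintro rfl rfl
    exact h.eq_add_two_of_not_adj h₄ h₆ huv hn hu hv
  · rintro rfl rfl
    exact h.eq_add_two_of_not_adj h₄ h₆ huv.symm hn' hv hu

/-- If every vertex is equal or adjacent to a vertex of an induced 7-cycle, then there are no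
four pairwise nonadjacent vertices. -/
theorem hFree_fourK1 (h : IsC7 G c) (h₄ : HFree G (cycleGraph 4)) (h₆ : HFree G (cycleGraph 6))
    (h₇ : HFree G (pathGraph 7)) (hne : ∀ v, cycleNbhd G c v ≠ ∅) : HFree G fourK1 := by
  intro hK
  obtain ⟨f⟩ := containsInduced_iff.1 hK
  have hf (a : Fin 4) : ∃ k i, cycleNbhd G c (f a) = profile k i :=
    (h.cycleNbhd_eq_profile h₄ h₆ h₇ (f a)).resolve_left (hne _)
  choose k i hki using hf
  have sep {a b : Fin 4} (hab : a ≠ b) : profilesSeparate (k a) (i a) (k b) (i b) = true :=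
    h.profilesSeparate_of_not_adj h₄ h₆ h₇ (f.injective.ne hab)
      (by rw [f.map_adj_iff]; simp [fourK1]) (hki a) (hki b)
  exact not_four_profilesSeparate _ _ _ _ (sep (a := 0) (b := 1) (by decide)) _ _
    (sep (a := 0) (b := 2) (by decide)) (sep (by decide)) _ _
    (sep (a := 0) (b := 3) (by decide)) (sep (by decide)) (sep (by decide))

/-- In a connected set `K` of vertices with no neighbors on an induced 7-cycle, no two
nonadjacent vertices with closed neighborhoods `{i, i + 1, i + 4}` and
`{i + 2, i + 3, i + 4, i + 5, i + 6}` on the cycle both have neighbors. -/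
theorem not_exists_path (h : IsC7 G c) (h₄ : HFree G (cycleGraph 4)) (h₆ : HFree G (cycleGraph 6))
    (h₇ : HFree G (pathGraph 7)) {i : Fin 7} (huv : u ≠ v) (hn : ¬ G.Adj u v)
    (hu : cycleNbhd G c u = profile 1 i) (hv : cycleNbhd G c v = profile 2 (i + 2)) {a b : V}
    (hb : cycleNbhd G c b = ∅) (hvb : G.Adj v b) (hua : G.Adj u a)
    (hba : Relation.ReflTransGen (fun x y => cycleNbhd G c y = ∅ ∧ G.Adj x y) b a) : False := by
  obtain ⟨d, hc, hprofile, hnot⟩ := h.exists_rotate i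
  have hu' := hprofile (by decide) hu
  have hv' := hprofile (by decide) hv
  have hnot' {x : V} (hx : cycleNbhd G c x = ∅) (j : Fin 7) : ¬ G.Adj (d j) x := fun h' =>
    hnot hx j h'.symm
  rw [sub_self] at hu'
  rw [add_sub_cancel_left] at hv'
  have hu'' (j : Fin 7) : G.Adj (d j) u ↔ j ∈ profile 1 0 := by rw [G.adj_comm, hu']
  have hv'' (j : Fin 7) : G.Adj (d j) v ↔ j ∈ profile 2 2 := by rw [G.adj_comm, hv']
  have common {x : V} (hx : cycleNbhd G c x = ∅) (hxv : G.Adj v x) (hxu : G.Adj u x) : False := by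
    refine h₄.false_of_C4 hxu.symm ((hu' 4).2 (by decide)) ((hv'' 4).2 (by decide)) hxv
      (hnot hx 4) hn ?_ huv
    rintro rfl
    exact hnot hx 3 (hc.adj (by decide))
  have near : cycleNbhd G c a = ∅ ∧ (G.Adj v a ∨
      ∃ x, cycleNbhd G c x = ∅ ∧ G.Adj v x ∧ G.Adj x a) := by
    clear hua
    induction hba with
    | refl => exact ⟨hb, Or.inl hvb⟩
    | @tail y z _ hyz ih =>
      obtain ⟨hz, hyz⟩ := hyz
      obtain ⟨hy, ih⟩ := ih
      refine ⟨hz, ?_⟩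
      rcases ih with hvy | ⟨x, hx, hvx, hxy⟩
      · exact Or.inr ⟨y, hy, hvy, hyz⟩
      · by_contra! hcon
        obtain ⟨hvz, hcon⟩ := hcon
        by_cases hvy : G.Adj v y
        · exact hcon y hy hvy hyz
        refine h₇.false_of_P7 (a := d 0) (b := d 1) (c := d 2) (d := v) (e := x) (f := y) (g := z)
          ?_ ?_ ?_ hvx hxy hyz ?_ ?_ (hnot' hx _) (hnot' hy _) (hnot' hz _) ?_ (hnot' hx _)
          (hnot' hy _) (hnot' hz _) (hnot' hx _) (hnot' hy _) (hnot' hz _) hvy hvz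
          (hcon x hx hvx) <;> simp only [hv'', hc _ _] <;> decide
  obtain ⟨ha, hva | ⟨x, hx, hvx, hxa⟩⟩ := near
  · exact common ha hva hua
  · refine h₆.false_of_C6 (a := u) (b := d 0) (c := d 6) (d := v) (e := x) (f := a)
      ?_ ?_ ?_ hvx hxa hua.symm ?_ hn (fun hux => common hx hvx hux) ?_ (hnot' hx _) (hnot' ha _)
      (hnot' hx _) (hnot' ha _) (fun hva => common ha hva hua) <;>
      simp only [hu', hv'', hc _ _] <;> decide

/-- If some vertex has no neighbor on an induced 7-cycle, then there is a clique-cutset. -/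
theorem hasCliqueCutset (h : IsC7 G c) (h₄ : HFree G (cycleGraph 4))
    (h₆ : HFree G (cycleGraph 6)) (h₇ : HFree G (pathGraph 7)) {a : V}
    (ha : cycleNbhd G c a = ∅) : HasCliqueCutset G := by
  set r : V → V → Prop := fun x y => cycleNbhd G c y = ∅ ∧ G.Adj x y
  set K : Set V := {v | Relation.ReflTransGen r a v}
  have K_empty {x : V} (hx : x ∈ K) : cycleNbhd G c x = ∅ := by
    cases hx with
    | refl => exact ha
    | tail _ hxy => exact hxy.1
  have K_symm {x : V} (hx : x ∈ K) : Relation.ReflTransGen r x a := by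
    induction hx with
    | refl => exact .refl
    | @tail y z hy hyz ih => exact .head ⟨K_empty hy, hyz.2.symm⟩ ih
  refine ⟨{v | cycleNbhd G c v ≠ ∅ ∧ ∃ x ∈ K, G.Adj v x}, ?_, ?_, ?_⟩
  · rintro u ⟨hu, x, hx, hux⟩ v ⟨hv, y, hy, hvy⟩ huv
    by_contra hn
    obtain ⟨k, i, hki⟩ := (h.cycleNbhd_eq_profile h₄ h₆ h₇ u).resolve_left hu
    obtain ⟨l, j, hlj⟩ := (h.cycleNbhd_eq_profile h₄ h₆ h₇ v).resolve_left hv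
    have kind_ne {w z : V} (hz : z ∈ K) (hwz : G.Adj w z) {k : Fin 4} {i : Fin 7}
        (hw : cycleNbhd G c w = profile k i) : k ≠ 0 := by
      rintro rfl
      have := (h.twin h₄ h₆ h₇ hw z).1 (Or.inr hwz.symm)
      simp [K_empty hz] at this
    rcases profilesSeparate_ne_zero k i l j (kind_ne hx hux hki) (kind_ne hy hvy hlj)
      (h.profilesSeparate_of_not_adj h₄ h₆ h₇ huv hn hki hlj) with
      ⟨rfl, rfl, rfl⟩ | ⟨rfl, rfl, rfl⟩
    · exact h.not_exists_path h₄ h₆ h₇ huv hn hki hlj (K_empty hy) hvy hux ((K_symm hy).trans hx)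
    · exact h.not_exists_path h₄ h₆ h₇ huv.symm (fun h' => hn h'.symm) hlj hki (K_empty hx) hux hvy
        ((K_symm hx).trans hy)
  · intro huniv
    exact (huniv ▸ Set.mem_univ a : a ∈ {v | cycleNbhd G c v ≠ ∅ ∧ ∃ x ∈ K, G.Adj v x}).1 ha
  · intro hcon
    have h0 : c 0 ∉ {v | cycleNbhd G c v ≠ ∅ ∧ ∃ x ∈ K, G.Adj v x} := by
      rintro ⟨-, x, hx, hadj⟩
      have := mem_cycleNbhd.2 (Or.inr hadj.symm : x = c 0 ∨ _)
      simp [K_empty hx] at this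
    obtain ⟨p⟩ := hcon.preconnected ⟨a, fun h' => h'.1 ha⟩ ⟨c 0, h0⟩
    have key : ∀ {x y : ↥({v | cycleNbhd G c v ≠ ∅ ∧ ∃ x ∈ K, G.Adj v x}ᶜ : Set V)},
        (G.induce {v | cycleNbhd G c v ≠ ∅ ∧ ∃ x ∈ K, G.Adj v x}ᶜ).Walk x y →
        x.1 ∈ K → y.1 ∈ K := by
      intro x y p
      induction p with
      | nil => exact id
      | @cons x y z hxy _ ih =>
        refine fun hx => ih (Relation.ReflTransGen.tail hx ⟨?_, hxy⟩)
        by_contra hy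
        exact y.2 ⟨hy, x, hx, (induce_adj.1 hxy).symm⟩
    have := K_empty (key p .refl)
    rw [h.cycleNbhd_self] at this
    revert this
    decide

/-- A clique-cutset separates some vertex from a path with five vertices of the 7-cycle, which
yields four pairwise nonadjacent vertices. -/
theorem not_hasCliqueCutset (h : IsC7 G c) (hK : HFree G fourK1) : ¬ HasCliqueCutset G := by
  classical
  rintro ⟨C, hC, hne, hdis⟩
  obtain ⟨i, hi⟩ := exists_of_pairwise_consecutive {j | c j ∈ C} (by
    simp only [Finset.mem_filter, Finset.mem_univ, true_and]
    intro p hp q hq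
    by_contra! hpq
    exact h.not_adj (by tauto) (hC hp hq (h.injective.ne hpq.1)))
  simp only [Finset.mem_filter, Finset.mem_univ, true_and] at hi
  have hd := h.rotate i
  replace hi (j : Fin 7) (hj : j ≠ 0 ∧ j ≠ 1) : c (j + i) ∉ C := by
    intro hmem
    have key : ∀ i j : Fin 7, j ≠ 0 ∧ j ≠ 1 → ¬ (j + i = i ∨ j + i = i + 1) := by decide
    exact key i j hj (hi _ hmem)
  set d := fun j => c (j + i)
  replace hi (j : Fin 7) (hj : j ≠ 0 ∧ j ≠ 1) : d j ∈ Cᶜ := hi j hj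
  clear_value d
  have hreach (j : Fin 7) (hj : j ≠ 0 ∧ j ≠ 1) :
      (G.induce Cᶜ).Reachable ⟨d 2, hi 2 (by decide)⟩ ⟨d j, hi j hj⟩ := by
    have step (p q : Fin 7) (hp : p ≠ 0 ∧ p ≠ 1) (hq : q ≠ 0 ∧ q ≠ 1) (hpq : q = p + 1) :
        (G.induce Cᶜ).Reachable ⟨d p, hi p hp⟩ ⟨d q, hi q hq⟩ :=
      Adj.reachable (induce_adj.2 (hd.adj (Or.inl hpq)))
    have h3 := step 2 3 (by decide) (by decide) (by decide)
    have h4 := h3.trans (step 3 4 (by decide) (by decide) (by decide))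
    have h5 := h4.trans (step 4 5 (by decide) (by decide) (by decide))
    have h6 := h5.trans (step 5 6 (by decide) (by decide) (by decide))
    fin_cases j
    · exact absurd rfl hj.1
    · exact absurd rfl hj.2
    · exact .rfl
    · exact h3
    · exact h4
    · exact h5
    · exact h6
  refine hdis ((connected_iff_exists_forall_reachable _).2 ⟨⟨d 2, hi 2 (by decide)⟩, ?_⟩)
  rintro ⟨v, hv⟩
  by_contra hvd
  have far (j : Fin 7) (hj : j ≠ 0 ∧ j ≠ 1) : v ≠ d j ∧ ¬ G.Adj v (d j) := by
    constructor
    · rintro rfl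
      exact hvd (hreach j hj)
    · intro hadj
      exact hvd ((hreach j hj).trans (Adj.reachable (induce_adj.2 hadj.symm)))
  exact hK.false_of_fourK1 (a := v) (b := d 2) (c := d 4) (d := d 6) (far 2 (by decide)).1
    (far 4 (by decide)).1 (far 6 (by decide)).1 (hd.injective.ne (by decide))
    (hd.injective.ne (by decide)) (hd.injective.ne (by decide)) (far 2 (by decide)).2
    (far 4 (by decide)).2 (far 6 (by decide)).2 (hd.not_adj (by decide)) (hd.not_adj (by decide))
    (hd.not_adj (by decide))

end IsC7

end SevenCycle

theorem hFree_pathGraph_seven_of_hFree_fourK1 {G : SimpleGraph V} (hK : HFree G fourK1) :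
    HFree G (pathGraph 7) := by
  intro hP
  obtain ⟨f⟩ := containsInduced_iff.1 hP
  refine hK.false_of_fourK1 (a := f 0) (b := f 2) (c := f 4) (d := f 6) ?_ ?_ ?_ ?_ ?_ ?_ ?_ ?_ ?_
    ?_ ?_ ?_ <;> simp [f.map_adj_iff, f.injective.eq_iff, pathGraph_adj]

/-- A graph is `(P_7,C_4,C_6)`-free, contains an induced `C_7`, and admits no
clique-cutset if and only if it is `(4K_1,C_4,C_6)`-free and contains an induced `C_7`. -/
theorem statement0 {V : Type*} [Fintype V] (G : SimpleGraph V) :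
    (HFree G (pathGraph 7) ∧ HFree G (cycleGraph 4) ∧ HFree G (cycleGraph 6) ∧
      ContainsInduced G (cycleGraph 7) ∧ ¬ HasCliqueCutset G) ↔
    (HFree G fourK1 ∧ HFree G (cycleGraph 4) ∧ HFree G (cycleGraph 6) ∧
      ContainsInduced G (cycleGraph 7)) := by
  constructor
  · rintro ⟨h₇, h₄, h₆, hC, hcut⟩
    obtain ⟨c, hc⟩ := exists_isC7 hC
    exact ⟨hc.hFree_fourK1 h₄ h₆ h₇ fun v hv => hcut (hc.hasCliqueCutset h₄ h₆ h₇ hv), h₄, h₆, hC⟩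
  · rintro ⟨hK, h₄, h₆, hC⟩
    obtain ⟨c, hc⟩ := exists_isC7 hC
    exact ⟨hFree_pathGraph_seven_of_hFree_fourK1 hK, h₄, h₆, hC, hc.not_hasCliqueCutset hK⟩

end Paper2P3
end

section
/- If a 4K_1-free graph G contains an induced C_7, then G does not admit a clique-cutset. -/
open SimpleGraph

namespace Paper2P3

variable {V : Type*}

/-- In a `4K_1`-free graph, every vertex equals or is adjacent to a member of any given
independent set of three vertices. -/
theorem HFree.eq_or_adj_of_independent {G : SimpleGraph V} (hfree : HFree G fourK1)
    {a b c : V} (hab : a ≠ b) (hac : a ≠ c) (hbc : b ≠ c)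
    (nab : ¬ G.Adj a b) (nac : ¬ G.Adj a c) (nbc : ¬ G.Adj b c) (v : V) :
    (a = v ∨ G.Adj a v) ∨ (b = v ∨ G.Adj b v) ∨ (c = v ∨ G.Adj c v) := by
  by_contra! h
  obtain ⟨⟨hav, nav⟩, ⟨hbv, nbv⟩, ⟨hcv, ncv⟩⟩ := h
  have hinj : Function.Injective ![a, b, c, v] := by
    intro x y
    fin_cases x <;> fin_cases y <;>
      simp [hab, hac, hbc, hav, hbv, hcv, hab.symm, hac.symm, hbc.symm, hav.symm, hbv.symm,
        hcv.symm]
  have hind : ∀ x y, ¬ G.Adj (![a, b, c, v] x) (![a, b, c, v] y) := by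
    intro x y
    fin_cases x <;> fin_cases y <;>
      simp [nab, nac, nbc, nav, nbv, ncv, mt Adj.symm nab, mt Adj.symm nac, mt Adj.symm nbc,
        mt Adj.symm nav, mt Adj.symm nbv, mt Adj.symm ncv]
  let φ : fourK1 ↪g G := ⟨⟨_, hinj⟩, fun {x y} => by
    simpa [fourK1] using hind x y⟩
  exact hfree ⟨Set.range φ, ⟨φ.isoInduceRange⟩⟩

/-- A clique of `G` meets an induced `C_7` only in (at most) two consecutive vertices. -/
theorem exists_consecutive_of_isClique {G : SimpleGraph V} (f : cycleGraph 7 ↪g G) {C : Set V}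
    (hC : G.IsClique C) : ∃ i : Fin 7, ∀ j, f j ∈ C → j = i ∨ j = i + 1 := by
  have hadj : ∀ j k, f j ∈ C → f k ∈ C → j ≠ k → (cycleGraph 7).Adj j k :=
    fun j k hj hk hjk => f.map_adj_iff.mp (hC hj hk (f.injective.ne hjk))
  by_cases hne : ∃ j, f j ∈ C
  · obtain ⟨j, hj⟩ := hne
    by_cases hj' : f (j + 1) ∈ C
    · refine ⟨j, fun k hk => ?_⟩
      have h₁ := hadj j k hj hk
      have h₂ := hadj (j + 1) k hj' hk
      clear hj hj' hk hadj
      revert j k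
      decide
    · refine ⟨j - 1, fun k hk => ?_⟩
      have h₁ := hadj j k hj hk
      have h₂ : k ≠ j + 1 := fun h => hj' (h ▸ hk)
      clear hj hj' hk hadj
      revert j k
      decide
  · exact ⟨0, fun j hj => (hne ⟨j, hj⟩).elim⟩

/-- If a `4K_1`-free graph contains an induced `C_7`, then it does not admit a
clique-cutset. -/
theorem statement2 {V : Type*} [Fintype V] (G : SimpleGraph V)
    (hfree : HFree G fourK1) (hC7 : ContainsInduced G (cycleGraph 7)) :
    ¬ HasCliqueCutset G := by
  rintro ⟨C, hC, -, hconn⟩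
  obtain ⟨s, ⟨e⟩⟩ := hC7
  let f : cycleGraph 7 ↪g G := (Embedding.induce s).comp e.toEmbedding
  obtain ⟨i, hi⟩ := exists_consecutive_of_isClique f hC
  have hout : ∀ k : Fin 7, k ≠ 0 → k ≠ 1 → f (i + k) ∈ Cᶜ := fun k h0 h1 hk => by
    rcases hi _ hk with h | h
    · exact h0 (by simpa using h)
    · exact h1 (by simpa using h)
  have hnadj : ∀ i : Fin 7, ¬ (cycleGraph 7).Adj (i + 2) (i + 4) ∧
      ¬ (cycleGraph 7).Adj (i + 2) (i + 6) ∧ ¬ (cycleGraph 7).Adj (i + 4) (i + 6) := by decide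
  have hedge : ∀ i : Fin 7, (cycleGraph 7).Adj (i + 2) (i + 3) ∧
      (cycleGraph 7).Adj (i + 3) (i + 4) ∧ (cycleGraph 7).Adj (i + 4) (i + 5) ∧
      (cycleGraph 7).Adj (i + 5) (i + 6) := by decide
  obtain ⟨n₂₄, n₂₆, n₄₆⟩ := hnadj i
  obtain ⟨e₂, e₃, e₄, e₅⟩ := hedge i
  let p : {k : Fin 7 // k ≠ 0 ∧ k ≠ 1} → ↥Cᶜ := fun k => ⟨f (i + k), hout k k.2.1 k.2.2⟩
  have hstep : ∀ a b, (cycleGraph 7).Adj (i + a.1) (i + b.1) →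
      (G.induce Cᶜ).Reachable (p a) (p b) := fun a b hab =>
    Adj.reachable (G := G.induce Cᶜ) (f.map_adj_iff.mpr hab)
  let p₂ := p ⟨2, by decide⟩
  have r₄ : (G.induce Cᶜ).Reachable p₂ (p ⟨4, by decide⟩) :=
    (hstep _ ⟨3, by decide⟩ e₂).trans (hstep _ _ e₃)
  have r₆ : (G.induce Cᶜ).Reachable p₂ (p ⟨6, by decide⟩) :=
    r₄.trans ((hstep _ ⟨5, by decide⟩ e₄).trans (hstep _ _ e₅))
  have hreach : ∀ v : ↥Cᶜ, (G.induce Cᶜ).Reachable p₂ v := by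
    intro v
    have hnear : ∀ k, (G.induce Cᶜ).Reachable p₂ (p k) →
        f (i + k) = v ∨ G.Adj (f (i + k)) v → (G.induce Cᶜ).Reachable p₂ v := by
      rintro k hk (h | h)
      · exact (Subtype.ext h : p k = v) ▸ hk
      · exact hk.trans (Adj.reachable (G := G.induce Cᶜ) (v := v) h)
    rcases hfree.eq_or_adj_of_independent
      (f.injective.ne (show i + 2 ≠ i + 4 by simp)) (f.injective.ne (show i + 2 ≠ i + 6 by simp))
      (f.injective.ne (show i + 4 ≠ i + 6 by simp)) (mt f.map_adj_iff.mp n₂₄)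
      (mt f.map_adj_iff.mp n₂₆) (mt f.map_adj_iff.mp n₄₆) v with h | h | h
    · exact hnear ⟨2, by decide⟩ (Reachable.refl _) h
    · exact hnear ⟨4, by decide⟩ r₄ h
    · exact hnear ⟨6, by decide⟩ r₆ h
  exact hconn ((connected_iff _).mpr ⟨fun u v => (hreach u).symm.trans (hreach v), ⟨p₂⟩⟩)

end Paper2P3
end

section
/- Every (P_7,C_4,C_6)-free graph that contains an induced C_7 either admits a special partition or admits a clique-cutset. -/
open SimpleGraph

namespace Paper2P3

variable {V : Type*}

section SevenCycle

variable {G : SimpleGraph V}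

theorem HFree.not_embedding {W : Type*} {H : SimpleGraph W} (h : HFree G H) (f : H ↪g G) :
    False := by
  refine h ⟨Set.range f, ⟨⟨Equiv.ofInjective f f.injective, ?_⟩⟩⟩
  intro a b
  simp

/-- In a twin-free pattern graph, adjacency alone determines an induced copy. -/
theorem HFree.not_adj_iff {W : Type*} {H : SimpleGraph W} (h : HFree G H)
    (hH : ∀ i j, (∀ k, H.Adj i k ↔ H.Adj j k) → i = j) (f : W → V)
    (hf : ∀ i j, G.Adj (f i) (f j) ↔ H.Adj i j) : False := by
  refine h.not_embedding ⟨⟨f, fun i j hij => hH i j fun k => ?_⟩, fun {a b} => hf a b⟩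
  rw [← hf, ← hf, hij]

theorem HFree.false_of_C4_s3 (h : HFree G (cycleGraph 4)) {a b c d : V}
    (hac : a ≠ c) (hbd : b ≠ d) (ab : G.Adj a b) (bc : G.Adj b c) (cd : G.Adj c d)
    (da : G.Adj d a) (nac : ¬ G.Adj a c) (nbd : ¬ G.Adj b d) : False := by
  have := ab.ne; have := bc.ne; have := cd.ne; have := da.ne
  have hinj : Function.Injective ![a, b, c, d] := by
    intro i j hij
    fin_cases i <;> fin_cases j <;> simp_all
  refine h.not_embedding ⟨⟨_, hinj⟩, fun {i j} => ?_⟩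
  rw [cycleGraph_adj, Function.Embedding.coeFn_mk]
  fin_cases i <;> fin_cases j <;>
    simp +decide [ab, bc, cd, da, nac, nbd, ab.symm, bc.symm, cd.symm, da.symm, G.adj_comm c a,
      G.adj_comm d b]

theorem HFree.false_of_C6_s3 (h : HFree G (cycleGraph 6)) (f : Fin 6 → V)
    (hf : ∀ i j, i < j → (G.Adj (f i) (f j) ↔ (j.val = i.val + 1 ∨ i.val = 0 ∧ j.val = 5))) :
    False := by
  refine h.not_adj_iff ?_ f fun i j => ?_
  · simp only [cycleGraph_adj]; decide
  · have key : ∀ i j : Fin 6, i < j →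
        ((cycleGraph 6).Adj i j ↔ (j.val = i.val + 1 ∨ i.val = 0 ∧ j.val = 5)) := by
      simp only [cycleGraph_adj]; decide
    rcases lt_trichotomy i j with hij | rfl | hij
    · rw [hf i j hij, key i j hij]
    · simp
    · rw [G.adj_comm (f i), SimpleGraph.adj_comm _ i, hf j i hij, key j i hij]

theorem HFree.false_of_P7_s3 (h : HFree G (pathGraph 7)) (f : Fin 7 → V)
    (hf : ∀ i j, i < j → (G.Adj (f i) (f j) ↔ j.val = i.val + 1)) : False := by
  refine h.not_adj_iff ?_ f fun i j => ?_
  · simp only [pathGraph_adj]; decide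
  · rcases lt_trichotomy i j with hij | rfl | hij
    · rw [hf i j hij, pathGraph_adj]; omega
    · simp
    · rw [G.adj_comm (f i), SimpleGraph.adj_comm _ i, hf j i hij, pathGraph_adj]; omega

/-- `x` lists the vertices of an induced seven-cycle in cyclic order. -/
def IsSevenCycle (G : SimpleGraph V) (x : ZMod 7 → V) : Prop :=
  Function.Injective x ∧ ∀ i j, G.Adj (x i) (x j) ↔ (j - i = 1 ∨ j - i = 6)

theorem exists_isSevenCycle (h : ContainsInduced G (cycleGraph 7)) : ∃ x, IsSevenCycle G x := by
  obtain ⟨s, ⟨e⟩⟩ := h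
  have key : ∀ i j : Fin 7, (cycleGraph 7).Adj i j ↔ (j - i = 1 ∨ j - i = 6) := by
    simp only [cycleGraph_adj]; decide
  exact ⟨fun i : Fin 7 => (e i : V), fun i j hij => e.injective (Subtype.ext hij),
    fun i j => e.map_adj_iff.trans (key i j)⟩

theorem IsSevenCycle.rotate {x : ZMod 7 → V} (hx : IsSevenCycle G x) (i : ZMod 7) :
    IsSevenCycle G fun k => x (k + i) := by
  refine ⟨fun a b hab => by simpa using hx.1 hab, fun a b => ?_⟩
  rw [hx.2, add_sub_add_right_eq_sub]

/-- The vertices whose closed neighborhood meets the cycle `x` exactly in `S + i`. -/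
def cycleClass (G : SimpleGraph V) (x : ZMod 7 → V) (S : Finset (ZMod 7)) (i : ZMod 7) : Set V :=
  {v | ∀ k, (v = x k ∨ G.Adj v (x k)) ↔ k - i ∈ S}

theorem mem_cycleClass_rotate {x : ZMod 7 → V} {S : Finset (ZMod 7)} {i j : ZMod 7} {v : V} :
    v ∈ cycleClass G (fun k => x (k + i)) S j ↔ v ∈ cycleClass G x S (j + i) := by
  constructor
  · intro h k
    have := h (k - i)
    simp only [sub_add_cancel] at this
    rw [this, sub_sub, add_comm]
  · intro h k
    rw [h (k + i), add_sub_add_right_eq_sub]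

/-- The trace of a vertex of the cycle or of a twin of such a vertex. -/
abbrev shapeX : Finset (ZMod 7) := {6, 0, 1}

/-- The trace of the vertices in the sets `Y_i` of a special partition. -/
abbrev shapeY : Finset (ZMod 7) := {0, 1, 4}

/-- The trace of the vertices in the sets `Z_i` of a special partition. -/
abbrev shapeZ : Finset (ZMod 7) := {0, 1, 2, 3, 4}

/-- The trace of the vertices in the set `W` of a special partition. -/
abbrev shapeW : Finset (ZMod 7) := {0, 1, 2, 3, 4, 5, 6}

/-- The possible traces, up to rotation, of a closed neighborhood on an induced seven-cycle. -/
def shapes : List (Finset (ZMod 7)) := [∅, shapeX, shapeY, shapeZ, shapeW]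

theorem IsSevenCycle.mem_cycleClass {x : ZMod 7 → V} (hx : IsSevenCycle G x) (i : ZMod 7) :
    x i ∈ cycleClass G x shapeX i := by
  intro k
  rw [hx.1.eq_iff, hx.2]
  revert i k; decide

theorem cycleClass_disjoint {x : ZMod 7 → V} {S T : Finset (ZMod 7)} {i j : ZMod 7}
    (h : ∃ k, ¬ (k - i ∈ S ↔ k - j ∈ T)) : Disjoint (cycleClass G x S i) (cycleClass G x T j) := by
  obtain ⟨k, hk⟩ := h
  exact Set.disjoint_left.2 fun v hv hw => hk ((hv k).symm.trans (hw k))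

theorem IsSevenCycle.ne_of_mem {x : ZMod 7 → V} (hx : IsSevenCycle G x) {S : Finset (ZMod 7)}
    {i : ZMod 7} (hS : ∀ j, ∃ k, ¬ (k - i ∈ S ↔ k - j ∈ shapeX)) {v : V}
    (hv : v ∈ cycleClass G x S i) (k : ZMod 7) : v ≠ x k := by
  rintro rfl
  exact Set.disjoint_left.1 (cycleClass_disjoint (hS k)) hv (hx.mem_cycleClass k)

theorem IsSevenCycle.adj_iff {x : ZMod 7 → V} (hx : IsSevenCycle G x) {S : Finset (ZMod 7)}
    {i : ZMod 7} (hS : ∀ j, ∃ k, ¬ (k - i ∈ S ↔ k - j ∈ shapeX)) {v : V}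
    (hv : v ∈ cycleClass G x S i) (k : ZMod 7) : G.Adj v (x k) ↔ k - i ∈ S := by
  rw [← hv k, or_iff_right (hx.ne_of_mem hS hv k)]

theorem exists_shape_of_gaps (P : ZMod 7 → Bool)
    (h2 : ∀ i, P i → P (i + 2) → P (i + 1))
    (h4 : ∀ i, P i → P (i + 4) → P (i + 1) ∨ P (i + 2) ∨ P (i + 3))
    (h6 : ∀ i, P i → P (i + 1) ∨ P (i + 2) ∨ P (i + 3) ∨ P (i + 4) ∨ P (i + 5)) :
    ∃ S ∈ shapes, ∃ i, ∀ k, P k ↔ k - i ∈ S := by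
  revert P; decide +kernel

theorem shape_determined_off_zero : ∀ S ∈ shapes, ∀ T ∈ shapes, ∀ a b : ZMod 7,
    (∀ k, k ≠ 0 → (k - a ∈ S ↔ k - b ∈ T)) → (0 - a ∈ S ↔ 0 - b ∈ T) := by
  decide +kernel

/-- `G` is `(P_7, C_4, C_6)`-free. -/
structure IsP7C4C6Free (G : SimpleGraph V) : Prop where
  p7 : HFree G (pathGraph 7)
  c4 : HFree G (cycleGraph 4)
  c6 : HFree G (cycleGraph 6)

variable {x : ZMod 7 → V}

theorem IsP7C4C6Free.gaps (h : IsP7C4C6Free G) (hx : IsSevenCycle G x) {v : V}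
    (hv : ∀ i, v ≠ x i) :
    (G.Adj v (x 0) → G.Adj v (x 2) → G.Adj v (x 1)) ∧
    (G.Adj v (x 0) → G.Adj v (x 4) → G.Adj v (x 1) ∨ G.Adj v (x 2) ∨ G.Adj v (x 3)) ∧
    (G.Adj v (x 0) → G.Adj v (x 1) ∨ G.Adj v (x 2) ∨ G.Adj v (x 3) ∨ G.Adj v (x 4) ∨
      G.Adj v (x 5)) := by
  refine ⟨fun h0 h2 => ?_, fun h0 h4 => ?_, fun h0 => ?_⟩ <;> by_contra! hn
  · exact h.c4.false_of_C4_s3 (hv 1) (hx.1.ne (by decide)) h0 ((hx.2 0 1).2 (by decide))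
      ((hx.2 1 2).2 (by decide)) h2.symm hn (by rw [hx.2]; decide)
  · refine h.c6.false_of_C6_s3 ![v, x 0, x 1, x 2, x 3, x 4] ?_
    simp +decide [Fin.forall_fin_succ, hx.2, h0, h4, hn]
  · refine h.p7.false_of_P7_s3 ![v, x 0, x 1, x 2, x 3, x 4, x 5] ?_
    simp +decide [Fin.forall_fin_succ, hx.2, h0, hn]

theorem IsP7C4C6Free.exists_mem_cycleClass (h : IsP7C4C6Free G) (hx : IsSevenCycle G x) (v : V) :
    ∃ S ∈ shapes, ∃ i, v ∈ cycleClass G x S i := by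
  classical
  by_cases hv : ∃ i, v = x i
  · obtain ⟨i, rfl⟩ := hv
    exact ⟨shapeX, by simp [shapes], i, hx.mem_cycleClass i⟩
  · push Not at hv
    obtain ⟨S, hS, i, hi⟩ := exists_shape_of_gaps (fun k => decide (G.Adj v (x k)))
      (fun i => by
        simpa [add_comm] using (h.gaps (hx.rotate i) fun k => hv _).1)
      (fun i => by
        simpa [add_comm] using (h.gaps (hx.rotate i) fun k => hv _).2.1)
      (fun i => by
        simpa [add_comm] using (h.gaps (hx.rotate i) fun k => hv _).2.2)
    exact ⟨S, hS, i, fun k => by simpa [hv k] using hi k⟩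

/-- A vertex with the same closed trace as `x 0` may replace it on the cycle. -/
theorem IsSevenCycle.update_zero (hx : IsSevenCycle G x) {u : V}
    (hu : u ∈ cycleClass G x shapeX 0) : IsSevenCycle G (Function.update x 0 u) := by
  by_cases hux : u = x 0
  · rwa [hux, Function.update_eq_self]
  have hne : ∀ k, u ≠ x k := by
    rintro k rfl
    have hk : k ≠ 0 := by rintro rfl; exact hux rfl
    refine Set.disjoint_left.1 (cycleClass_disjoint ?_) hu (hx.mem_cycleClass k)
    revert hk; clear * -; revert k; decide
  have hadj : ∀ k, G.Adj u (x k) ↔ k ∈ shapeX := fun k => by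
    rw [← sub_zero k, ← hu k, or_iff_right (hne k), sub_zero]
  refine ⟨fun i j hij => ?_, fun i j => ?_⟩
  · by_cases hi : i = 0 <;> by_cases hj : j = 0
    · rw [hi, hj]
    · simp [hi, hj, hne] at hij
    · simp [hi, hj, (hne _).symm] at hij
    · exact hx.1 (by simpa [hi, hj] using hij)
  · by_cases hi : i = 0 <;> by_cases hj : j = 0
    · subst hi hj; simp; decide
    · subst hi
      rw [Function.update_self, Function.update_of_ne hj, hadj]
      revert hj; revert j; decide
    · subst hj
      rw [Function.update_self, Function.update_of_ne hi, G.adj_comm, hadj]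
      revert hi; revert i; decide
    · rw [Function.update_of_ne hj, Function.update_of_ne hi, hx.2]

theorem IsP7C4C6Free.twin_zero (h : IsP7C4C6Free G) (hx : IsSevenCycle G x) {u : V}
    (hu : u ∈ cycleClass G x shapeX 0) (v : V) :
    (v = u ∨ G.Adj v u) ↔ (v = x 0 ∨ G.Adj v (x 0)) := by
  obtain ⟨S, hS, i, hi⟩ := h.exists_mem_cycleClass (hx.update_zero hu) v
  obtain ⟨T, hT, j, hj⟩ := h.exists_mem_cycleClass hx v
  have h1 := hi 0
  rw [Function.update_self] at h1
  rw [h1, hj 0]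
  refine shape_determined_off_zero S hS T hT i j fun k hk => ?_
  rw [← hi k, ← hj k, Function.update_of_ne hk]

/-- Vertices in the same class `X_i` are true twins. -/
theorem IsP7C4C6Free.adj_iff_of_mem_X (h : IsP7C4C6Free G) (hx : IsSevenCycle G x) {u v : V}
    {S : Finset (ZMod 7)} {i j : ZMod 7} (hu : u ∈ cycleClass G x shapeX i)
    (hv : v ∈ cycleClass G x S j) (huv : u ≠ v) : G.Adj u v ↔ i - j ∈ S := by
  have h1 := h.twin_zero (hx.rotate i) (u := u) (mem_cycleClass_rotate.2 (by rwa [zero_add])) v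
  rw [zero_add, hv i, or_iff_right huv.symm] at h1
  rw [G.adj_comm, h1]

theorem IsP7C4C6Free.adj_of_common (h : IsP7C4C6Free G) (hx : IsSevenCycle G x) {u v : V}
    {S T : Finset (ZMod 7)} {i j : ZMod 7}
    (hS : ∀ j, ∃ k, ¬ (k - i ∈ S ↔ k - j ∈ shapeX)) (hT : ∀ i, ∃ k, ¬ (k - j ∈ T ↔ k - i ∈ shapeX))
    (hc : ∃ k l, k - l ∉ shapeX ∧ k - i ∈ S ∧ l - i ∈ S ∧ k - j ∈ T ∧ l - j ∈ T)
    (hu : u ∈ cycleClass G x S i) (hv : v ∈ cycleClass G x T j) (huv : u ≠ v) : G.Adj u v := by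
  obtain ⟨k, l, hkl, hk, hl, hk', hl'⟩ := hc
  have hu' := hx.adj_iff hS hu
  have hv' := hx.adj_iff hT hv
  by_contra hn
  refine h.c4.false_of_C4_s3 huv (b := x k) (d := x l) ?_ ((hu' k).2 hk) ((hv' k).2 hk').symm
    ((hv' l).2 hl') ((hu' l).2 hl).symm hn ?_
  · intro hxe
    rw [hx.1 hxe] at hkl
    simp at hkl
  · rw [hx.2]
    revert hkl; clear * -; revert k l; decide

theorem shapeY_spec (i : ZMod 7) : ∀ j, ∃ k, ¬ (k - i ∈ shapeY ↔ k - j ∈ shapeX) := by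
  revert i; decide

theorem shapeZ_spec (i : ZMod 7) : ∀ j, ∃ k, ¬ (k - i ∈ shapeZ ↔ k - j ∈ shapeX) := by
  revert i; decide

theorem shapeW_spec (i : ZMod 7) : ∀ j, ∃ k, ¬ (k - i ∈ shapeW ↔ k - j ∈ shapeX) := by
  revert i; decide

theorem IsP7C4C6Free.not_adj_of_cross (h : IsP7C4C6Free G) (hx : IsSevenCycle G x) {u v : V}
    {S T : Finset (ZMod 7)} {i j : ZMod 7}
    (hS : ∀ j, ∃ k, ¬ (k - i ∈ S ↔ k - j ∈ shapeX)) (hT : ∀ i, ∃ k, ¬ (k - j ∈ T ↔ k - i ∈ shapeX))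
    (hc : ∃ k l, (l - k = 1 ∨ l - k = 6) ∧ k - i ∈ S ∧ l - i ∉ S ∧ l - j ∈ T ∧ k - j ∉ T)
    (hu : u ∈ cycleClass G x S i) (hv : v ∈ cycleClass G x T j) : ¬ G.Adj u v := by
  obtain ⟨k, l, hkl, hk, hl, hl', hk'⟩ := hc
  have hu' := hx.adj_iff hS hu
  have hv' := hx.adj_iff hT hv
  intro huv
  exact h.c4.false_of_C4_s3 (hx.ne_of_mem hS hu l) (hx.ne_of_mem hT hv k).symm ((hu' k).2 hk)
    ((hx.2 k l).2 hkl) ((hv' l).2 hl').symm huv.symm (mt (hu' l).1 hl)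
    fun hkv => hk' ((hv' k).1 hkv.symm)

section Exclusions

variable {u v : V}

theorem IsP7C4C6Free.false_of_Y_Y_one (h : IsP7C4C6Free G) (hx : IsSevenCycle G x)
    (hu : u ∈ cycleClass G x shapeY 0) (hv : v ∈ cycleClass G x shapeY 1) : False := by
  have huv := h.not_adj_of_cross hx (shapeY_spec _) (shapeY_spec _) (by decide) hu hv
  have hu := hx.adj_iff (shapeY_spec _) hu
  have hv := hx.adj_iff (shapeY_spec _) hv
  have hv' : ∀ k, G.Adj (x k) v ↔ k - 1 ∈ shapeY := fun k => by rw [G.adj_comm, hv]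
  refine h.p7.false_of_P7_s3 ![u, x 0, x 6, x 5, v, x 2, x 3] ?_
  simp +decide [Fin.forall_fin_succ, hx.2, hu, hv, hv', huv]

theorem IsP7C4C6Free.false_of_Y_Y_two (h : IsP7C4C6Free G) (hx : IsSevenCycle G x)
    (hu : u ∈ cycleClass G x shapeY 0) (hv : v ∈ cycleClass G x shapeY 2) : False := by
  have huv := h.not_adj_of_cross hx (shapeY_spec _) (shapeY_spec _) (by decide) hu hv
  have hu := hx.adj_iff (shapeY_spec _) hu
  have hv := hx.adj_iff (shapeY_spec _) hv
  have hv' : ∀ k, G.Adj (x k) v ↔ k - 2 ∈ shapeY := fun k => by rw [G.adj_comm, hv]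
  refine h.c6.false_of_C6_s3 ![u, x 4, x 3, v, x 6, x 0] ?_
  simp +decide [Fin.forall_fin_succ, hx.2, hu, hv, hv', huv]

theorem IsP7C4C6Free.false_of_Y_Z_five (h : IsP7C4C6Free G) (hx : IsSevenCycle G x)
    (hu : u ∈ cycleClass G x shapeY 0) (hv : v ∈ cycleClass G x shapeZ 5) : False := by
  have huv := h.not_adj_of_cross hx (shapeY_spec _) (shapeZ_spec _) (by decide) hu hv
  have hu := hx.adj_iff (shapeY_spec _) hu
  have hv := hx.adj_iff (shapeZ_spec _) hv
  have hv' : ∀ k, G.Adj (x k) v ↔ k - 5 ∈ shapeZ := fun k => by rw [G.adj_comm, hv]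
  refine h.c6.false_of_C6_s3 ![u, x 4, x 3, x 2, v, x 0] ?_
  simp +decide [Fin.forall_fin_succ, hx.2, hu, hv, hv', huv]

theorem IsP7C4C6Free.false_of_Y_Z_six (h : IsP7C4C6Free G) (hx : IsSevenCycle G x)
    (hu : u ∈ cycleClass G x shapeY 0) (hv : v ∈ cycleClass G x shapeZ 6) : False := by
  have huv := h.not_adj_of_cross hx (shapeY_spec _) (shapeZ_spec _) (by decide) hu hv
  have hu := hx.adj_iff (shapeY_spec _) hu
  have hv := hx.adj_iff (shapeZ_spec _) hv
  have hv' : ∀ k, G.Adj (x k) v ↔ k - 6 ∈ shapeZ := fun k => by rw [G.adj_comm, hv]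
  refine h.c6.false_of_C6_s3 ![u, x 4, x 5, x 6, v, x 1] ?_
  simp +decide [Fin.forall_fin_succ, hx.2, hu, hv, hv', huv]

theorem IsP7C4C6Free.false_of_Z_Z_two (h : IsP7C4C6Free G) (hx : IsSevenCycle G x)
    (hu : u ∈ cycleClass G x shapeZ 0) (hv : v ∈ cycleClass G x shapeZ 2) : False := by
  refine h.not_adj_of_cross hx (shapeZ_spec _) (shapeZ_spec _) (by decide) hu hv
    (h.adj_of_common hx (shapeZ_spec _) (shapeZ_spec _) (by decide) hu hv ?_)
  rintro rfl
  exact Set.disjoint_left.1 (cycleClass_disjoint (by decide)) hu hv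

end Exclusions

/-- The classes `Y_i` and `Y_j` cannot both be nonempty unless `j - i` is `0`, `3` or `4`. -/
theorem IsP7C4C6Free.Y_Y_diff (h : IsP7C4C6Free G) (hx : IsSevenCycle G x) {u v : V} {i j : ZMod 7}
    (hu : u ∈ cycleClass G x shapeY i) (hv : v ∈ cycleClass G x shapeY j) :
    j - i ∈ ({0, 3, 4} : Finset (ZMod 7)) := by
  have key : ∀ {u v : V} {i d : ZMod 7}, u ∈ cycleClass G x shapeY i →
      v ∈ cycleClass G x shapeY (d + i) → d ≠ 1 ∧ d ≠ 2 := by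
    intro u v i d hu hv
    rw [← mem_cycleClass_rotate] at hv
    replace hu := mem_cycleClass_rotate.2 (by rwa [zero_add] : u ∈ cycleClass G x shapeY (0 + i))
    constructor <;> rintro rfl
    · exact h.false_of_Y_Y_one (hx.rotate i) hu hv
    · exact h.false_of_Y_Y_two (hx.rotate i) hu hv
  have h1 := key hu (d := j - i) (by rwa [sub_add_cancel])
  have h2 := key hv (d := i - j) (by rwa [sub_add_cancel])
  revert h1 h2; clear * -; revert i j; decide

/-- The classes `Y_i` and `Z_j` cannot both be nonempty if `j - i` is `5` or `6`. -/
theorem IsP7C4C6Free.Y_Z_diff (h : IsP7C4C6Free G) (hx : IsSevenCycle G x) {u v : V} {i j : ZMod 7}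
    (hu : u ∈ cycleClass G x shapeY i) (hv : v ∈ cycleClass G x shapeZ j) :
    j - i ∈ ({0, 1, 2, 3, 4} : Finset (ZMod 7)) := by
  have key : ∀ {d : ZMod 7}, v ∈ cycleClass G x shapeZ (d + i) → d ≠ 5 ∧ d ≠ 6 := by
    intro d hv
    rw [← mem_cycleClass_rotate] at hv
    replace hu := mem_cycleClass_rotate.2 (by rwa [zero_add] : u ∈ cycleClass G x shapeY (0 + i))
    constructor <;> rintro rfl
    · exact h.false_of_Y_Z_five (hx.rotate i) hu hv
    · exact h.false_of_Y_Z_six (hx.rotate i) hu hv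
  have h1 := key (d := j - i) (by rwa [sub_add_cancel])
  revert h1; clear * -; revert i j; decide

/-- The classes `Z_i` and `Z_j` cannot both be nonempty if `j - i` is `2` or `5`. -/
theorem IsP7C4C6Free.Z_Z_diff (h : IsP7C4C6Free G) (hx : IsSevenCycle G x) {u v : V} {i j : ZMod 7}
    (hu : u ∈ cycleClass G x shapeZ i) (hv : v ∈ cycleClass G x shapeZ j) :
    j - i ∈ ({0, 1, 3, 4, 6} : Finset (ZMod 7)) := by
  have key : ∀ {u v : V} {i d : ZMod 7}, u ∈ cycleClass G x shapeZ i →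
      v ∈ cycleClass G x shapeZ (d + i) → d ≠ 2 := by
    rintro u v i d hu hv rfl
    rw [← mem_cycleClass_rotate] at hv
    replace hu := mem_cycleClass_rotate.2 (by rwa [zero_add] : u ∈ cycleClass G x shapeZ (0 + i))
    exact h.false_of_Z_Z_two (hx.rotate i) hu hv
  have h1 := key hu (d := j - i) (by rwa [sub_add_cancel])
  have h2 := key hv (d := i - j) (by rwa [sub_add_cancel])
  revert h1 h2; clear * -; revert i j; decide

theorem IsP7C4C6Free.adj_Y_Y (h : IsP7C4C6Free G) (hx : IsSevenCycle G x) {u v : V} {i j : ZMod 7}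
    (hu : u ∈ cycleClass G x shapeY i) (hv : v ∈ cycleClass G x shapeY j) (huv : u ≠ v) :
    G.Adj u v := by
  refine h.adj_of_common hx (shapeY_spec _) (shapeY_spec _) ?_ hu hv huv
  have := h.Y_Y_diff hx hu hv
  revert this; clear * -; revert i j; decide

theorem IsP7C4C6Free.adj_Z_Z (h : IsP7C4C6Free G) (hx : IsSevenCycle G x) {u v : V} {i j : ZMod 7}
    (hu : u ∈ cycleClass G x shapeZ i) (hv : v ∈ cycleClass G x shapeZ j) (huv : u ≠ v) :
    G.Adj u v := by
  refine h.adj_of_common hx (shapeZ_spec _) (shapeZ_spec _) ?_ hu hv huv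
  clear * -; revert i j; decide

theorem shapeY_shapeZ_ne (i j : ZMod 7) : ∃ k, ¬ (k - i ∈ shapeY ↔ k - j ∈ shapeZ) := by
  revert i j; decide

theorem IsP7C4C6Free.adj_Y_Z (h : IsP7C4C6Free G) (hx : IsSevenCycle G x) {u v : V} {i j : ZMod 7}
    (hu : u ∈ cycleClass G x shapeY i) (hv : v ∈ cycleClass G x shapeZ j) (hij : j ≠ i + 2) :
    G.Adj u v := by
  refine h.adj_of_common hx (shapeY_spec _) (shapeZ_spec _) ?_ hu hv ?_
  · have := h.Y_Z_diff hx hu hv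
    revert this hij; clear * -; revert i j; decide
  · rintro rfl
    exact Set.disjoint_left.1 (cycleClass_disjoint (shapeY_shapeZ_ne i j)) hu hv

theorem IsP7C4C6Free.not_adj_Y_Z (h : IsP7C4C6Free G) (hx : IsSevenCycle G x) {u v : V} {i : ZMod 7}
    (hu : u ∈ cycleClass G x shapeY i) (hv : v ∈ cycleClass G x shapeZ (i + 2)) :
    ¬ G.Adj u v := by
  refine h.not_adj_of_cross hx (shapeY_spec _) (shapeZ_spec _) ?_ hu hv
  clear * -; revert i; decide

theorem IsP7C4C6Free.adj_Y_W (h : IsP7C4C6Free G) (hx : IsSevenCycle G x) {u v : V} {i j : ZMod 7}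
    (hu : u ∈ cycleClass G x shapeY i) (hv : v ∈ cycleClass G x shapeW j) (huv : u ≠ v) :
    G.Adj u v := by
  refine h.adj_of_common hx (shapeY_spec _) (shapeW_spec _) ?_ hu hv huv
  clear * -; revert i j; decide

theorem IsP7C4C6Free.adj_Z_W (h : IsP7C4C6Free G) (hx : IsSevenCycle G x) {u v : V} {i j : ZMod 7}
    (hu : u ∈ cycleClass G x shapeZ i) (hv : v ∈ cycleClass G x shapeW j) (huv : u ≠ v) :
    G.Adj u v := by
  refine h.adj_of_common hx (shapeZ_spec _) (shapeW_spec _) ?_ hu hv huv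
  clear * -; revert i j; decide

theorem IsP7C4C6Free.adj_W_W (h : IsP7C4C6Free G) (hx : IsSevenCycle G x) {u v : V} {i j : ZMod 7}
    (hu : u ∈ cycleClass G x shapeW i) (hv : v ∈ cycleClass G x shapeW j) (huv : u ≠ v) :
    G.Adj u v := by
  refine h.adj_of_common hx (shapeW_spec _) (shapeW_spec _) ?_ hu hv huv
  clear * -; revert i j; decide

theorem mem_shapeW (k : ZMod 7) : k ∈ shapeW := by
  revert k; decide

theorem cycleClass_shapeW (i : ZMod 7) : cycleClass G x shapeW i = cycleClass G x shapeW 0 := by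
  ext v; simp only [cycleClass, mem_shapeW, Set.mem_ofPred_eq]

theorem cycleClass_empty (i : ZMod 7) : cycleClass G x ∅ i = cycleClass G x ∅ 0 := by
  ext v; simp [cycleClass]

theorem IsP7C4C6Free.admitsSpecialPartition (h : IsP7C4C6Free G) (hx : IsSevenCycle G x)
    (hA : cycleClass G x ∅ 0 = ∅) : AdmitsSpecialPartition G := by
  have hXX : ∀ i j, i ≠ j → Disjoint (cycleClass G x shapeX i) (cycleClass G x shapeX j) :=
    fun i j hij => cycleClass_disjoint (by revert i j; decide)
  have hYY : ∀ i j, i ≠ j → Disjoint (cycleClass G x shapeY i) (cycleClass G x shapeY j) :=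
    fun i j hij => cycleClass_disjoint (by revert i j; decide)
  have hZZ : ∀ i j, i ≠ j → Disjoint (cycleClass G x shapeZ i) (cycleClass G x shapeZ j) :=
    fun i j hij => cycleClass_disjoint (by revert i j; decide)
  have hXY : ∀ i j, Disjoint (cycleClass G x shapeX i) (cycleClass G x shapeY j) :=
    fun i j => cycleClass_disjoint (by revert i j; decide)
  have hXZ : ∀ i j, Disjoint (cycleClass G x shapeX i) (cycleClass G x shapeZ j) :=
    fun i j => cycleClass_disjoint (by revert i j; decide)
  have hYZ : ∀ i j, Disjoint (cycleClass G x shapeY i) (cycleClass G x shapeZ j) :=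
    fun i j => cycleClass_disjoint (shapeY_shapeZ_ne i j)
  have hXW : ∀ i, Disjoint (cycleClass G x shapeX i) (cycleClass G x shapeW 0) :=
    fun i => cycleClass_disjoint (by revert i; decide)
  have hYW : ∀ i, Disjoint (cycleClass G x shapeY i) (cycleClass G x shapeW 0) :=
    fun i => cycleClass_disjoint (by revert i; decide)
  have hZW : ∀ i, Disjoint (cycleClass G x shapeZ i) (cycleClass G x shapeW 0) :=
    fun i => cycleClass_disjoint (by revert i; decide)
  -- the adjacency between a class `X_i` and another class can be read off the cycle
  have cX : ∀ {S : Finset (ZMod 7)} {i j : ZMod 7},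
      Disjoint (cycleClass G x shapeX i) (cycleClass G x S j) → i - j ∈ S →
      Complete G (cycleClass G x shapeX i) (cycleClass G x S j) := by
    intro S i j hd hij u hu v hv
    exact (h.adj_iff_of_mem_X hx hu hv (hd.ne_of_mem hu hv)).2 hij
  have aX : ∀ {S : Finset (ZMod 7)} {i j : ZMod 7},
      Disjoint (cycleClass G x shapeX i) (cycleClass G x S j) → i - j ∉ S →
      Anticomplete G (cycleClass G x shapeX i) (cycleClass G x S j) := by
    intro S i j hd hij u hu v hv
    exact mt (h.adj_iff_of_mem_X hx hu hv (hd.ne_of_mem hu hv)).1 hij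
  have eYY : ∀ i, (cycleClass G x shapeY i).Nonempty → ∀ j,
      j - i ∉ ({0, 3, 4} : Finset (ZMod 7)) → cycleClass G x shapeY j = ∅ := by
    rintro i ⟨u, hu⟩ j hj
    exact Set.eq_empty_of_forall_notMem fun v hv => hj (h.Y_Y_diff hx hu hv)
  have eYZ : ∀ i, (cycleClass G x shapeY i).Nonempty → ∀ j,
      j - i ∉ ({0, 1, 2, 3, 4} : Finset (ZMod 7)) → cycleClass G x shapeZ j = ∅ := by
    rintro i ⟨u, hu⟩ j hj
    exact Set.eq_empty_of_forall_notMem fun v hv => hj (h.Y_Z_diff hx hu hv)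
  have eZZ : ∀ i, (cycleClass G x shapeZ i).Nonempty → ∀ j,
      j - i ∉ ({0, 1, 3, 4, 6} : Finset (ZMod 7)) → cycleClass G x shapeZ j = ∅ := by
    rintro i ⟨u, hu⟩ j hj
    exact Set.eq_empty_of_forall_notMem fun v hv => hj (h.Z_Z_diff hx hu hv)
  refine ⟨cycleClass G x shapeX, cycleClass G x shapeY, cycleClass G x shapeZ,
    cycleClass G x shapeW 0, hXX, hYY, hZZ, hXY, hXZ, hYZ, hXW, hYW, hZW, ?_, ?_, ?_, ?_, ?_, ?_,
    ?_, ?_, ?_, ?_, ?_, ?_⟩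
  · refine Set.eq_univ_of_forall fun v => ?_
    obtain ⟨S, hS, i, hi⟩ := h.exists_mem_cycleClass hx v
    simp only [shapes, List.mem_cons, List.not_mem_nil, or_false] at hS
    rcases hS with rfl | rfl | rfl | rfl | rfl
    · rw [cycleClass_empty, hA] at hi
      exact hi.elim
    · exact .inl (.inl (.inl (Set.mem_iUnion_of_mem i hi)))
    · exact .inl (.inl (.inr (Set.mem_iUnion_of_mem i hi)))
    · exact .inl (.inr (Set.mem_iUnion_of_mem i hi))
    · rw [cycleClass_shapeW] at hi
      exact .inr hi
  · exact fun i u hu v hv huv => (h.adj_iff_of_mem_X hx hu hv huv).2 (by simp)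
  · exact fun i u hu v hv huv => h.adj_Y_Y hx hu hv huv
  · exact fun i u hu v hv huv => h.adj_Z_Z hx hu hv huv
  · exact fun u hu v hv huv => h.adj_W_W hx hu hv huv
  · exact fun i => ⟨x i, hx.mem_cycleClass i⟩
  · intro i
    refine ⟨cX (hXX _ _ ?_) ?_, cX (hXX _ _ ?_) ?_, aX (hXX _ _ ?_) ?_, aX (hXX _ _ ?_) ?_,
      aX (hXX _ _ ?_) ?_, aX (hXX _ _ ?_) ?_⟩ <;> revert i <;> decide
  · intro i
    refine ⟨cX (hXY _ _) ?_, cX (hXY _ _) ?_, cX (hXY _ _) ?_, cX (hXZ _ _) ?_, cX (hXZ _ _) ?_,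
      cX (hXZ _ _) ?_, cX (hXZ _ _) ?_, cX (hXZ _ _) ?_, cX (hXW _) ?_, aX (hXY _ _) ?_,
      aX (hXY _ _) ?_, aX (hXY _ _) ?_, aX (hXY _ _) ?_, aX (hXZ _ _) ?_, aX (hXZ _ _) ?_⟩ <;>
      revert i <;> decide
  · intro i hi
    refine ⟨⟨eYY i hi _ ?_, eYY i hi _ ?_, eYY i hi _ ?_, eYY i hi _ ?_, eYZ i hi _ ?_,
      eYZ i hi _ ?_⟩, ?_⟩
    rotate_right
    · rw [← Set.not_nonempty_iff_eq_empty, or_iff_not_imp_left, not_not]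
      intro h3
      refine eYY _ h3 _ ?_
      clear * -; revert i; decide
    all_goals clear * -; revert i; decide
  · intro i hi
    refine ⟨eZZ i hi _ ?_, eZZ i hi _ ?_⟩ <;> clear * - <;> revert i <;> decide
  · intro i
    refine ⟨fun u hu v hv => h.adj_Y_Y hx hu hv ((hYY _ _ ?_).ne_of_mem hu hv),
      fun u hu v hv => h.adj_Y_Y hx hu hv ((hYY _ _ ?_).ne_of_mem hu hv),
      fun u hu v hv => h.adj_Y_Z hx hu hv ?_, fun u hu v hv => h.adj_Y_Z hx hu hv ?_,
      fun u hu v hv => h.adj_Y_Z hx hu hv ?_, fun u hu v hv => h.adj_Y_Z hx hu hv ?_,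
      fun u hu v hv => h.adj_Y_W hx hu hv ((hYW _).ne_of_mem hu hv),
      fun u hu v hv => h.not_adj_Y_Z hx hu hv⟩ <;> clear * - <;> revert i <;> decide
  · intro i
    refine ⟨fun u hu v hv => h.adj_Z_Z hx hu hv ((hZZ _ _ ?_).ne_of_mem hu hv),
      fun u hu v hv => h.adj_Z_Z hx hu hv ((hZZ _ _ ?_).ne_of_mem hu hv),
      fun u hu v hv => h.adj_Z_Z hx hu hv ((hZZ _ _ ?_).ne_of_mem hu hv),
      fun u hu v hv => h.adj_Z_Z hx hu hv ((hZZ _ _ ?_).ne_of_mem hu hv),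
      fun u hu v hv => h.adj_Z_W hx hu hv ((hZW _).ne_of_mem hu hv)⟩ <;>
      clear * - <;> revert i <;> decide

theorem Walk.adj_getVert_iff_of_length_eq_dist {W : Type*} {H : SimpleGraph W} {u v : W}
    {p : H.Walk u v} (hp : p.length = H.dist u v) {i j : ℕ} (hij : i < j) (hj : j ≤ p.length) :
    H.Adj (p.getVert i) (p.getVert j) ↔ j = i + 1 := by
  constructor
  · intro hadj
    have h1 := dist_le ((p.take i).append (.cons hadj (p.drop j)))
    rw [Walk.length_append, Walk.length_cons, Walk.take_length, Walk.drop_length, ← hp] at h1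
    omega
  · rintro rfl
    exact p.adj_getVert_succ (by omega)

/-- No induced path joins `Y_0` to `Z_2` through vertices without neighbors on the cycle. -/
theorem IsP7C4C6Free.false_of_path (h : IsP7C4C6Free G) (hx : IsSevenCycle G x) (f : ℕ → V) (m : ℕ)
    (hf : ∀ i j, i < j → j ≤ m → (G.Adj (f i) (f j) ↔ j = i + 1))
    (h0 : f 0 ∈ cycleClass G x shapeY 0) (hm : f m ∈ cycleClass G x shapeZ 2)
    (hA : ∀ i, 0 < i → i < m → f i ∈ cycleClass G x ∅ 0) : False := by
  have hyz := h.not_adj_Y_Z hx h0 hm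
  have hy := hx.adj_iff (shapeY_spec _) h0
  have hz := hx.adj_iff (shapeZ_spec _) hm
  have hA' : ∀ i, 0 < i → i < m → ∀ k, ¬ G.Adj (f i) (x k) := fun i hi hi' k hadj => by
    simpa using (hA i hi hi' k).1 (.inr hadj)
  have hm0 : m ≠ 0 := by
    rintro rfl
    exact Set.disjoint_left.1 (cycleClass_disjoint (shapeY_shapeZ_ne _ _)) h0 hm
  have hm1 : m ≠ 1 := by
    rintro rfl
    exact hyz ((hf 0 1 (by simp) le_rfl).2 rfl)
  obtain rfl | rfl | rfl | rfl | hm6 : m = 2 ∨ m = 3 ∨ m = 4 ∨ m = 5 ∨ 6 ≤ m := by omega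
  · refine h.c4.false_of_C4_s3 (a := f 0) (b := f 1) (c := f 2) (d := x 4) ?_ ?_
      ((hf 0 1 (by simp) (by simp)).2 rfl) ((hf 1 2 (by simp) le_rfl).2 rfl)
      ((hz 4).2 (by decide)) ((hy 4).2 (by decide)).symm hyz (hA' 1 (by simp) (by simp) 4)
    · exact (cycleClass_disjoint (shapeY_shapeZ_ne _ _)).ne_of_mem h0 hm
    · intro hb
      simpa using (hA 1 (by simp) (by simp) 4).1 (.inl hb)
  · refine h.c6.false_of_C6_s3 ![f 0, f 1, f 2, f 3, x 2, x 1] ?_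
    simp +decide [Fin.forall_fin_succ, hx.2, hy, hz, hf, hA']
  · refine h.c6.false_of_C6_s3 ![f 0, f 1, f 2, f 3, f 4, x 4] ?_
    simp +decide [Fin.forall_fin_succ, hy, hz, hf, hA']
  · refine h.p7.false_of_P7_s3 ![f 0, f 1, f 2, f 3, f 4, f 5, x 2] ?_
    simp +decide [Fin.forall_fin_succ, hy, hz, hf, hA']
  · exact h.p7.false_of_P7_s3 (fun i => f i) fun i j hij => hf i j hij (by omega)

theorem IsP7C4C6Free.not_reachable_Y_Z (h : IsP7C4C6Free G) (hx : IsSevenCycle G x) {y z : V}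
    {i : ZMod 7} (hy : y ∈ cycleClass G x shapeY i) (hz : z ∈ cycleClass G x shapeZ (i + 2))
    {s : Set V} (hs : s ⊆ cycleClass G x ∅ 0 ∪ {y, z}) (hys : y ∈ s) (hzs : z ∈ s) :
    ¬ (G.induce s).Reachable ⟨y, hys⟩ ⟨z, hzs⟩ := by
  intro hr
  obtain ⟨p, hpath, hp⟩ := hr.exists_path_of_dist
  rw [add_comm, ← mem_cycleClass_rotate] at hz
  rw [← zero_add i, ← mem_cycleClass_rotate] at hy
  refine h.false_of_path (hx.rotate i) (fun n => (p.getVert n : V)) p.length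
    (fun a b hab hb => Walk.adj_getVert_iff_of_length_eq_dist hp hab hb)
    (by simpa using hy) (by simpa using hz) fun n hn hn' => ?_
  rw [mem_cycleClass_rotate, zero_add, cycleClass_empty]
  rcases hs (p.getVert n).2 with hA | hyn | hzn
  · exact hA
  · have := hpath.getVert_injOn (x₁ := n) (x₂ := 0) hn'.le (by simp)
      (Subtype.ext (by simpa using hyn))
    omega
  · have := hpath.getVert_injOn (x₁ := n) (x₂ := p.length) hn'.le (by simp)
      (Subtype.ext (by simpa using hzn))
    omega

/-- The component of `a` in the subgraph induced by `A`. -/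
def componentIn (G : SimpleGraph V) (A : Set V) (a : V) : Set V :=
  {v | Relation.ReflTransGen (fun u w => G.Adj u w ∧ w ∈ A) a v}

theorem componentIn_subset {A : Set V} {a : V} (ha : a ∈ A) : componentIn G A a ⊆ A := by
  rintro v (hv : Relation.ReflTransGen _ a v)
  rcases hv.cases_tail with rfl | ⟨_, _, _, h⟩
  exacts [ha, h]

theorem reachable_of_mem_componentIn {A s : Set V} {a v : V} (hs : A ⊆ s) (ha : a ∈ s)
    (hv : v ∈ componentIn G A a) : ∃ hvs : v ∈ s, (G.induce s).Reachable ⟨a, ha⟩ ⟨v, hvs⟩ := by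
  change Relation.ReflTransGen _ a v at hv
  induction hv with
  | refl => exact ⟨ha, .rfl⟩
  | tail _ huw ih =>
    obtain ⟨hus, hr⟩ := ih
    exact ⟨hs huw.2, hr.trans (Adj.reachable (by simpa using huw.1))⟩

/-- The attachment of a component of the vertices far from the cycle is a clique cutset. -/
theorem IsP7C4C6Free.hasCliqueCutset (h : IsP7C4C6Free G) (hx : IsSevenCycle G x) {a : V}
    (ha : a ∈ cycleClass G x ∅ 0) : HasCliqueCutset G := by
  set A := cycleClass G x ∅ 0
  set D := componentIn G A a
  have hDA : D ⊆ A := componentIn_subset ha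
  have haD : a ∈ D := Relation.ReflTransGen.refl
  have hclosed : ∀ u ∈ D, ∀ v ∈ A, G.Adj u v → v ∈ D := fun u hu v hv huv =>
    Relation.ReflTransGen.tail hu ⟨huv, hv⟩
  set C : Set V := {v | v ∉ A ∧ ∃ d ∈ D, G.Adj v d}
  have hYZ : ∀ u ∈ C, ∀ v ∈ C, ∀ i j, u ∈ cycleClass G x shapeY i →
      v ∈ cycleClass G x shapeZ j → G.Adj u v := by
    rintro u ⟨-, d, hd, hud⟩ v ⟨-, e, he, hve⟩ i j hui hvj
    by_cases hij : j = i + 2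
    · subst hij
      have hAs : A ⊆ A ∪ {u, v} := Set.subset_union_left
      obtain ⟨hds, hrd⟩ := reachable_of_mem_componentIn hAs (hAs ha) hd
      obtain ⟨hes, hre⟩ := reachable_of_mem_componentIn hAs (hAs ha) he
      refine absurd ?_ (h.not_reachable_Y_Z hx hui hvj subset_rfl (by simp) (by simp))
      have h1 : (G.induce (A ∪ {u, v})).Adj ⟨u, by simp⟩ ⟨d, hds⟩ := hud
      have h2 : (G.induce (A ∪ {u, v})).Adj ⟨v, by simp⟩ ⟨e, hes⟩ := hve
      exact h1.reachable.trans (hrd.symm.trans (hre.trans h2.reachable.symm))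
    · exact h.adj_Y_Z hx hui hvj hij
  have hclass : ∀ u ∈ C, (∃ i, u ∈ cycleClass G x shapeY i) ∨ (∃ i, u ∈ cycleClass G x shapeZ i) ∨
      u ∈ cycleClass G x shapeW 0 := by
    rintro u ⟨huA, d, hd, hud⟩
    obtain ⟨S, hS, i, hi⟩ := h.exists_mem_cycleClass hx u
    simp only [shapes, List.mem_cons, List.not_mem_nil, or_false] at hS
    rcases hS with rfl | rfl | rfl | rfl | rfl
    · rw [cycleClass_empty] at hi
      exact absurd hi huA
    · have := (h.adj_iff_of_mem_X hx hi (hDA hd) hud.ne).1 hud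
      simp at this
    · exact .inl ⟨i, hi⟩
    · exact .inr (.inl ⟨i, hi⟩)
    · rw [cycleClass_shapeW] at hi
      exact .inr (.inr hi)
  refine ⟨C, fun u hu v hv huv => ?_, fun hCu => ?_, fun hconn => ?_⟩
  · rcases hclass u hu with ⟨i, hui⟩ | ⟨i, hui⟩ | hui <;>
      rcases hclass v hv with ⟨j, hvj⟩ | ⟨j, hvj⟩ | hvj
    · exact h.adj_Y_Y hx hui hvj huv
    · exact hYZ u hu v hv i j hui hvj
    · exact h.adj_Y_W hx hui hvj huv
    · exact (hYZ v hv u hu j i hvj hui).symm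
    · exact h.adj_Z_Z hx hui hvj huv
    · exact h.adj_Z_W hx hui hvj huv
    · exact (h.adj_Y_W hx hvj hui huv.symm).symm
    · exact (h.adj_Z_W hx hvj hui huv.symm).symm
    · exact h.adj_W_W hx hui hvj huv
  · exact (hCu ▸ Set.mem_univ a : a ∈ C).1 ha
  · have hxA : x 0 ∉ A := fun h0 => by simpa using (h0 0).1 (.inl rfl)
    have hxC : x 0 ∈ Cᶜ := by
      rintro ⟨-, d, hd, hxd⟩
      simpa using (hDA hd 0).1 (.inr hxd.symm)
    have haC : a ∈ Cᶜ := fun haC => haC.1 ha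
    obtain ⟨p⟩ := hconn.preconnected ⟨a, haC⟩ ⟨x 0, hxC⟩
    have key : ∀ {u v : (Cᶜ : Set V)}, (G.induce Cᶜ).Walk u v → (u : V) ∈ D → (v : V) ∈ D := by
      intro u v p
      induction p with
      | nil => exact id
      | @cons u w v huw _ ih =>
        intro hu
        have huw' : G.Adj (u : V) (w : V) := huw
        refine ih (hclosed u hu w ?_ huw')
        by_contra hwA
        exact w.2 ⟨hwA, u, hu, huw'.symm⟩
    exact hxA (hDA (key p haD))

end SevenCycle

/-- Every `(P_7,C_4,C_6)`-free graph that contains an induced `C_7` either admits a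
special partition or admits a clique-cutset. -/
theorem statement3 {V : Type*} [Fintype V] (G : SimpleGraph V)
    (hP7 : HFree G (pathGraph 7)) (hC4 : HFree G (cycleGraph 4))
    (hC6 : HFree G (cycleGraph 6)) (hC7 : ContainsInduced G (cycleGraph 7)) :
    AdmitsSpecialPartition G ∨ HasCliqueCutset G := by
  have h : IsP7C4C6Free G := ⟨hP7, hC4, hC6⟩
  obtain ⟨x, hx⟩ := exists_isSevenCycle hC7
  rcases (cycleClass G x ∅ 0).eq_empty_or_nonempty with hA | ⟨a, ha⟩
  · exact .inl (h.admitsSpecialPartition hx hA)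
  · exact .inr (h.hasCliqueCutset hx ha)

end Paper2P3
end
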